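/- arXiv:1407.3553 — 3 statements merged into one kernel-verified Lean document; each statement's English description precedes it below -/
import Mathlib

section
/- There exists a universal constant C > 0 such that for every n ≥ 1, every centered Gaussian random vector Y = (Y_1, …, Y_n) in ℝⁿ with covariance matrix Γ (Γ_{ij} = E[Y_i Y_j]), and every h > 0, one has P( | ‖Y‖_2 − E‖Y‖_2 | ≥ h ) ≤ C·exp( − h² / (2·‖Γ‖_2) ), where ‖Y‖_2 is the Euclidean norm and ‖Γ‖_2 is the operator (spectral) norm of Γ, i.e. its largest eigenvalue. -/
open MeasureTheory ProbabilityTheory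

/-- The Euclidean norm of a vector in `ℝⁿ`. -/
noncomputable def euclNorm {n : ℕ} (v : Fin n → ℝ) : ℝ :=
  Real.sqrt (∑ i, v i ^ 2)

/-- The operator (spectral) norm of an `n × n` real matrix with respect to the
Euclidean norm. -/
noncomputable def specNorm {n : ℕ} (Γ : Matrix (Fin n) (Fin n) ℝ) : ℝ :=
  sSup {r : ℝ | ∃ v : Fin n → ℝ, euclNorm v = 1 ∧ r = euclNorm (Γ.mulVec v)}

/-- `Y = (Y_1, …, Y_n)` is a centered Gaussian random vector: every real linear
combination of its coordinates has a centered real Gaussian distribution. -/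
def IsCenteredGaussianVector {Ω : Type*} [MeasurableSpace Ω] (P : Measure Ω)
    {n : ℕ} (Y : Fin n → Ω → ℝ) : Prop :=
  ∀ coef : Fin n → ℝ, ∃ v : NNReal,
    Measure.map (fun ω => ∑ i, coef i * Y i ω) P = gaussianReal 0 v

section GaussianMeasure

variable {E : Type*} [NormedAddCommGroup E]

lemma LipschitzWith.abs_le_add_mul_norm {k : E → ℝ} {K : NNReal} (hk : LipschitzWith K k) (x : E) :
    |k x| ≤ |k 0| + K * ‖x‖ := by
  have h1 := hk.norm_sub_le x 0
  have h2 : ‖k x‖ ≤ ‖k x - k 0‖ + ‖k 0‖ := norm_le_norm_sub_add _ _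
  simp only [sub_zero, Real.norm_eq_abs] at h1 h2
  linarith

variable [NormedSpace ℝ E]

/-- The linear map on `E × E` that swaps the components along `b` measured by `ℓ`. -/
noncomputable def exchangeAlong (ℓ : StrongDual ℝ E) (b : E) : E × E →L[ℝ] E × E :=
  let d := (ℓ ∘L ContinuousLinearMap.snd ℝ E E - ℓ ∘L ContinuousLinearMap.fst ℝ E E).smulRight b
  (ContinuousLinearMap.fst ℝ E E + d).prod (ContinuousLinearMap.snd ℝ E E - d)

lemma exchangeAlong_apply (ℓ : StrongDual ℝ E) (b : E) (p : E × E) :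
    exchangeAlong ℓ b p = (p.1 + (ℓ p.2 - ℓ p.1) • b, p.2 - (ℓ p.2 - ℓ p.1) • b) := by
  simp [exchangeAlong]

variable [MeasurableSpace E] [BorelSpace E] {μ : Measure E} [IsGaussian μ]

lemma integrable_dual_mul_dual (m m' : StrongDual ℝ E) :
    Integrable (fun x ↦ m x * m' x) μ :=
  (IsGaussian.memLp_dual μ m 2 (by simp)).integrable_mul (IsGaussian.memLp_dual μ m' 2 (by simp))

variable [CompleteSpace E] [SecondCountableTopology E]

lemma integral_dual_eq_zero (hμ : μ[id] = 0) (m : StrongDual ℝ E) : ∫ x, m x ∂μ = 0 := by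
  have := IsGaussian.integral_dual (μ := μ) m
  simp only [id_eq] at hμ
  rw [this, hμ, map_zero]

lemma variance_dual_eq (hμ : μ[id] = 0) (m : StrongDual ℝ E) :
    Var[m; μ] = ∫ x, m x * m x ∂μ := by
  rw [variance_of_integral_eq_zero (by fun_prop) (integral_dual_eq_zero hμ m)]
  simp [sq]

lemma variance_dual_sub_smul (hμ : μ[id] = 0) (m ℓ : StrongDual ℝ E) (t : ℝ) :
    Var[(m - t • ℓ : StrongDual ℝ E); μ]
      = ∫ x, m x * m x ∂μ - 2 * t * ∫ x, m x * ℓ x ∂μ + t ^ 2 * ∫ x, ℓ x * ℓ x ∂μ := by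
  rw [variance_dual_eq hμ]
  have h1 := integrable_dual_mul_dual (μ := μ) m m
  have h2 := (integrable_dual_mul_dual (μ := μ) m ℓ).const_mul (2 * t)
  have h3 := (integrable_dual_mul_dual (μ := μ) ℓ ℓ).const_mul (t ^ 2)
  have h12 : Integrable (fun x ↦ m x * m x - 2 * t * (m x * ℓ x)) μ := h1.sub h2
  rw [← integral_const_mul, ← integral_const_mul, ← integral_sub h1 h2, ← integral_add h12 h3]
  congr 1 with x
  simp
  ring

lemma map_exchangeAlong (hμ : μ[id] = 0) {ℓ : StrongDual ℝ E} {b : E}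
    (hb : ∀ m : StrongDual ℝ E, ∫ x, m x * ℓ x ∂μ = (∫ x, ℓ x * ℓ x ∂μ) * m b) :
    (μ.prod μ).map (exchangeAlong ℓ b) = μ.prod μ := by
  refine Measure.ext_of_charFunDual ?_
  ext M
  set m := M ∘L ContinuousLinearMap.inl ℝ E E with hm
  set m' := M ∘L ContinuousLinearMap.inr ℝ E E with hm'
  have hM (x y : E) : M (x, y) = m x + m' y := by
    rw [hm, hm', ContinuousLinearMap.comp_apply, ContinuousLinearMap.comp_apply, ← map_add]
    simp
  have h1 : (M ∘L exchangeAlong ℓ b) ∘L ContinuousLinearMap.inl ℝ E E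
      = m - (m b - m' b) • ℓ := by
    ext x
    simp [exchangeAlong_apply, hM]
    ring
  have h2 : (M ∘L exchangeAlong ℓ b) ∘L ContinuousLinearMap.inr ℝ E E
      = m' - (m' b - m b) • ℓ := by
    ext x
    simp [exchangeAlong_apply, hM]
    ring
  rw [charFunDual_map, charFunDual_prod, charFunDual_prod, h1, h2]
  simp_rw [IsGaussian.charFunDual_eq_of_integral_eq_zero hμ, ← Complex.exp_add]
  congr 1
  rw [← hm, ← hm']
  rw [variance_dual_sub_smul hμ, variance_dual_sub_smul hμ, variance_dual_eq hμ,
    variance_dual_eq hμ, hb m, hb m']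
  push_cast
  ring

lemma integrable_exp_mul_norm (μ : Measure E) [IsGaussian μ] (a : ℝ) :
    Integrable (fun x ↦ Real.exp (a * ‖x‖)) μ := by
  obtain ⟨C, hC, hint⟩ := IsGaussian.exists_integrable_exp_sq μ
  refine (hint.const_mul (Real.exp (a ^ 2 / (4 * C)))).mono' (by fun_prop) (ae_of_all _ fun x ↦ ?_)
  rw [Real.norm_of_nonneg (Real.exp_pos _).le, ← Real.exp_add]
  gcongr
  have : a ^ 2 / (4 * C) + C * ‖x‖ ^ 2 - a * ‖x‖ = (a - 2 * C * ‖x‖) ^ 2 / (4 * C) := by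
    field_simp
    ring
  have : 0 ≤ (a - 2 * C * ‖x‖) ^ 2 / (4 * C) := by positivity
  linarith

lemma integrable_exp_mul_norm_add_norm (μ : Measure E) [IsGaussian μ] (a : ℝ) :
    Integrable (fun p : E × E ↦ Real.exp (a * (‖p.1‖ + ‖p.2‖))) (μ.prod μ) := by
  simp_rw [mul_add, Real.exp_add]
  exact (integrable_exp_mul_norm μ a).mul_prod (integrable_exp_mul_norm μ a)

lemma LipschitzWith.memLp_two_of_isGaussian (μ : Measure E) [IsGaussian μ] {k : E → ℝ}
    {K : NNReal} (hk : LipschitzWith K k) : MemLp k 2 μ := by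
  have h := ((IsGaussian.memLp_two_id (μ := μ)).norm.const_mul (K : ℝ)).add
    (memLp_const (|k 0|))
  refine h.of_le hk.continuous.aestronglyMeasurable (ae_of_all _ fun x ↦ ?_)
  refine (hk.abs_le_add_mul_norm x).trans ?_
  rw [add_comm]
  exact Real.le_norm_self _

lemma LipschitzWith.integrable_exp_mul_of_isGaussian (μ : Measure E) [IsGaussian μ] {k : E → ℝ}
    {K : NNReal} (hk : LipschitzWith K k) (t : ℝ) :
    Integrable (fun x ↦ Real.exp (t * k x)) μ := by
  have hkc := hk.continuous
  refine ((integrable_exp_mul_norm μ (|t| * K)).const_mul (Real.exp (|t| * |k 0|))).mono'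
    (by fun_prop) (ae_of_all _ fun x ↦ ?_)
  rw [Real.norm_of_nonneg (Real.exp_pos _).le, ← Real.exp_add]
  gcongr
  calc t * k x ≤ |t| * |k x| := (le_abs_self _).trans_eq (abs_mul _ _)
    _ ≤ |t| * (|k 0| + K * ‖x‖) := by
      gcongr
      exact hk.abs_le_add_mul_norm x
    _ = _ := by ring

/-- A Gaussian covariance inequality: the covariance of a Lipschitz function and a linear form. -/
lemma integral_lipschitz_mul_dual_le (hμ : μ[id] = 0) {k : E → ℝ} {K : NNReal}
    (hk : LipschitzWith K k) (ℓ : StrongDual ℝ E) :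
    ∫ x, k x * ℓ x ∂μ ≤ K * ‖∫ x, ℓ x • x ∂μ‖ := by
  set s := ∫ x, ℓ x * ℓ x ∂μ with hs_def
  have hk2 := hk.memLp_two_of_isGaussian μ
  have hℓ2 := IsGaussian.memLp_dual μ ℓ 2 (by simp)
  have hs0 : 0 ≤ s := integral_nonneg fun x ↦ mul_self_nonneg _
  rcases hs0.eq_or_lt with hs | hs
  · have h0 : (fun x ↦ ℓ x * ℓ x) =ᵐ[μ] 0 :=
      (integral_eq_zero_iff_of_nonneg (fun x ↦ mul_self_nonneg _)
        (integrable_dual_mul_dual ℓ ℓ)).1 hs.symm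
    have : (fun x ↦ k x * ℓ x) =ᵐ[μ] 0 := by
      filter_upwards [h0] with x hx
      simp [mul_self_eq_zero.1 hx]
    rw [integral_congr_ae this]
    simp only [Pi.zero_apply, integral_zero]
    positivity
  set c := ∫ x, ℓ x • x ∂μ with hc_def
  have hint : Integrable (fun x ↦ ℓ x • x) μ :=
    memLp_one_iff_integrable.1 ((IsGaussian.memLp_two_id (μ := μ)).smul hℓ2)
  have hc (m : StrongDual ℝ E) : ∫ x, m x * ℓ x ∂μ = m c := by
    rw [hc_def, ← m.integral_comp_comm hint]
    simp [mul_comm]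
  set b := s⁻¹ • c with hb_def
  have hb (m : StrongDual ℝ E) : ∫ x, m x * ℓ x ∂μ = s * m b := by
    simp [hc, hb_def, hs.ne']
  have hℓb : ℓ b = 1 := by
    have := hb ℓ
    rw [← hs_def] at this
    exact mul_left_cancel₀ hs.ne' (by linarith)
  have hT : MeasurePreserving (exchangeAlong ℓ b) (μ.prod μ) (μ.prod μ) :=
    ⟨by fun_prop, map_exchangeAlong hμ hb⟩
  have hk1 : MemLp (fun p : E × E ↦ k p.1) 2 (μ.prod μ) :=
    hk2.comp_measurePreserving measurePreserving_fst
  have hℓ1 : MemLp (fun p : E × E ↦ ℓ p.1) 2 (μ.prod μ) :=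
    hℓ2.comp_measurePreserving measurePreserving_fst
  have hℓ1' : MemLp (fun p : E × E ↦ ℓ p.2) 2 (μ.prod μ) :=
    hℓ2.comp_measurePreserving measurePreserving_snd
  set D : E × E → ℝ := fun p ↦ ℓ p.1 - ℓ p.2 with hD
  have hD2 : MemLp D 2 (μ.prod μ) := hℓ1.sub hℓ1'
  have hDk : Integrable (fun p : E × E ↦ D p * k p.1) (μ.prod μ) := hD2.integrable_mul hk1
  have hkk : ∫ p, D p * k p.1 ∂(μ.prod μ) = ∫ x, k x * ℓ x ∂μ := by
    have e (p : E × E) : D p * k p.1 = (k p.1 * ℓ p.1) * 1 - k p.1 * ℓ p.2 := by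
      simp only [hD]
      ring
    simp_rw [e]
    rw [integral_sub, integral_prod_mul (fun x ↦ k x * ℓ x) (fun _ ↦ (1 : ℝ)),
      integral_prod_mul k ℓ, integral_dual_eq_zero hμ]
    · simp
    · simpa using! hk1.integrable_mul hℓ1
    · exact hk1.integrable_mul hℓ1'
  have hTD (p : E × E) : D (exchangeAlong ℓ b p) = - D p := by
    simp [hD, exchangeAlong_apply, hℓb]
  have hsw : ∫ p, D p * k p.1 ∂(μ.prod μ)
      = ∫ p, - D p * k (exchangeAlong ℓ b p).1 ∂(μ.prod μ) := by
    conv_lhs => rw [← hT.map_eq]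
    rw [integral_map hT.measurable.aemeasurable (by rw [hT.map_eq]; exact hDk.aestronglyMeasurable)]
    simp_rw [hTD]
  have hDk' : Integrable (fun p : E × E ↦ - D p * k (exchangeAlong ℓ b p).1) (μ.prod μ) := by
    have := hT.integrable_comp_of_integrable hDk
    simpa [Function.comp_def, hTD] using! this
  have hDD : ∫ p, D p * D p ∂(μ.prod μ) = 2 * s := by
    have e (p : E × E) : D p * D p
        = (ℓ p.1 * ℓ p.1) * 1 + 1 * (ℓ p.2 * ℓ p.2) - 2 * (ℓ p.1 * ℓ p.2) := by
      simp only [hD]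
      ring
    have i1 : Integrable (fun p : E × E ↦ (ℓ p.1 * ℓ p.1) * 1) (μ.prod μ) := by
      simpa using! hℓ1.integrable_mul hℓ1
    have i2 : Integrable (fun p : E × E ↦ 1 * (ℓ p.2 * ℓ p.2)) (μ.prod μ) := by
      simpa using! hℓ1'.integrable_mul hℓ1'
    have i3 : Integrable (fun p : E × E ↦ 2 * (ℓ p.1 * ℓ p.2)) (μ.prod μ) :=
      (hℓ1.integrable_mul hℓ1').const_mul 2
    have i12 : Integrable (fun p : E × E ↦ (ℓ p.1 * ℓ p.1) * 1 + 1 * (ℓ p.2 * ℓ p.2))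
      (μ.prod μ) := i1.add i2
    simp_rw [e]
    rw [integral_sub i12 i3, integral_add i1 i2, integral_const_mul (2 : ℝ),
      integral_prod_mul (fun x ↦ ℓ x * ℓ x) (fun _ ↦ (1 : ℝ)),
      integral_prod_mul (fun _ ↦ (1 : ℝ)) (fun x ↦ ℓ x * ℓ x), integral_prod_mul ℓ ℓ,
      integral_dual_eq_zero hμ]
    simp
    ring
  have hDDi : Integrable (fun p ↦ D p * D p) (μ.prod μ) := hD2.integrable_mul hD2
  have key : 2 * ∫ x, k x * ℓ x ∂μ ≤ K * ‖b‖ * (2 * s) := by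
    rw [← hDD]
    calc 2 * ∫ x, k x * ℓ x ∂μ
        = ∫ p, (D p * k p.1 + - D p * k (exchangeAlong ℓ b p).1) ∂(μ.prod μ) := by
          rw [integral_add hDk hDk', ← hsw, hkk, two_mul]
      _ ≤ ∫ p, K * ‖b‖ * (D p * D p) ∂(μ.prod μ) := by
          refine integral_mono (hDk.add hDk') (hDDi.const_mul _) fun p ↦ ?_
          have h1 := hk.norm_sub_le p.1 (exchangeAlong ℓ b p).1
          have h2 : p.1 - (exchangeAlong ℓ b p).1 = D p • b := by
            simp only [exchangeAlong_apply, hD]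
            module
          rw [h2, norm_smul] at h1
          calc D p * k p.1 + - D p * k (exchangeAlong ℓ b p).1
              = D p * (k p.1 - k (exchangeAlong ℓ b p).1) := by ring
            _ ≤ |D p| * |k p.1 - k (exchangeAlong ℓ b p).1| := by
              rw [← abs_mul]
              exact le_abs_self _
            _ ≤ |D p| * (K * (|D p| * ‖b‖)) := by
              gcongr
              exact h1
            _ = K * ‖b‖ * (|D p| * |D p|) := by ring
            _ = K * ‖b‖ * (D p * D p) := by rw [abs_mul_abs_self]
      _ = K * ‖b‖ * ∫ p, D p * D p ∂(μ.prod μ) := integral_const_mul _ _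
  have hbc : ‖b‖ * s = ‖c‖ := by
    rw [hb_def, norm_smul, norm_inv, Real.norm_of_nonneg hs0]
    field_simp
  nlinarith

/-- Covariance inequality for Gaussian measures, obtained by rotating one of two independent copies
onto the other. -/
lemma integral_mul_exp_sub_le (hμ : μ[id] = 0) {L : NNReal}
    (hL : ∀ ℓ : StrongDual ℝ E, ‖∫ x, ℓ x • x ∂μ‖ ≤ L * ‖ℓ‖) {f : E → ℝ}
    (hf : LipschitzWith 1 f) (hd : ContDiff ℝ 1 f) {t : ℝ} (ht : 0 ≤ t) :
    ∫ x, f x * Real.exp (t * f x) ∂μ - (∫ x, f x ∂μ) * ∫ x, Real.exp (t * f x) ∂μ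
      ≤ t * L * ∫ x, Real.exp (t * f x) ∂μ := by
  set M := ∫ x, Real.exp (t * f x) ∂μ with hM
  set R : ℝ → E × E →L[ℝ] E × E := fun θ ↦ ContinuousLinearMap.rotation θ with hR
  have hR1 (θ : ℝ) (p : E × E) : (R θ p).1 = Real.cos θ • p.1 + Real.sin θ • p.2 := rfl
  have hR2 (θ : ℝ) (p : E × E) : (R θ p).2 = -Real.sin θ • p.1 + Real.cos θ • p.2 := rfl
  have hRμ (θ : ℝ) : (μ.prod μ).map (R θ) = μ.prod μ := IsGaussian.map_rotation_eq_self hμ θ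
  have hfd : Continuous (fderiv ℝ f) := hd.continuous_fderiv one_ne_zero
  have hfc : Continuous f := hd.continuous
  set F : ℝ → E × E → ℝ := fun θ p ↦ f p.2 * Real.exp (t * f (R θ p).1) with hF
  set F' : ℝ → E × E → ℝ := fun θ p ↦
    f p.2 * (Real.exp (t * f (R θ p).1) * (t * fderiv ℝ f (R θ p).1 (R θ p).2)) with hF'
  have hFd (θ : ℝ) (p : E × E) : HasDerivAt (F · p) (F' θ p) θ := by
    have h1 : HasDerivAt (fun θ ↦ (R θ p).1) (R θ p).2 θ := by
      simp_rw [hR1, hR2]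
      exact ((Real.hasDerivAt_cos θ).smul_const p.1).add ((Real.hasDerivAt_sin θ).smul_const p.2)
    have h2 : HasDerivAt (fun θ ↦ f (R θ p).1) (fderiv ℝ f (R θ p).1 (R θ p).2) θ :=
      ((hd.differentiable one_ne_zero (R θ p).1).hasFDerivAt).comp_hasDerivAt θ h1
    exact ((h2.const_mul t).exp).const_mul _
  have hf_le (x : E) : |f x| ≤ |f 0| + ‖x‖ := by simpa using hf.abs_le_add_mul_norm x
  have hfd_le (x : E) : ‖fderiv ℝ f x‖ ≤ 1 := by
    simpa using norm_fderiv_le_of_lipschitz ℝ hf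
  have hfexp (x : E) : |f x| ≤ (|f 0| + 1) * Real.exp ‖x‖ := by
    have h1 := hf_le x
    have h2 := Real.add_one_le_exp ‖x‖
    nlinarith [norm_nonneg x, abs_nonneg (f 0)]
  have hn1 (θ : ℝ) (p : E × E) : ‖(R θ p).1‖ ≤ ‖p.1‖ + ‖p.2‖ := by
    rw [hR1]
    refine (norm_add_le _ _).trans (add_le_add ?_ ?_) <;> rw [norm_smul] <;>
      refine mul_le_of_le_one_left (norm_nonneg _) ?_
    exacts [Real.abs_cos_le_one θ, Real.abs_sin_le_one θ]
  have hn2 (θ : ℝ) (p : E × E) : ‖(R θ p).2‖ ≤ ‖p.1‖ + ‖p.2‖ := by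
    rw [hR2]
    refine (norm_add_le _ _).trans (add_le_add ?_ ?_) <;> rw [norm_smul] <;>
      refine mul_le_of_le_one_left (norm_nonneg _) ?_
    exacts [(norm_neg _).trans_le (Real.abs_sin_le_one θ), Real.abs_cos_le_one θ]
  have hexp_le (x : E) (N : ℝ) (hN : ‖x‖ ≤ N) :
      Real.exp (t * f x) ≤ Real.exp (t * |f 0|) * Real.exp (t * N) := by
    rw [← Real.exp_add]
    gcongr
    rw [← mul_add]
    gcongr
    exact (le_abs_self _).trans ((hf_le x).trans (by linarith))
  set C₀ := (|f 0| + 1) * Real.exp (t * |f 0|) with hC₀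
  have hF_le (θ : ℝ) (p : E × E) : ‖F θ p‖ ≤ C₀ * Real.exp ((t + 1) * (‖p.1‖ + ‖p.2‖)) := by
    calc ‖F θ p‖ = |f p.2| * Real.exp (t * f (R θ p).1) := by
          simp [hF]
      _ ≤ ((|f 0| + 1) * Real.exp (‖p.1‖ + ‖p.2‖))
          * (Real.exp (t * |f 0|) * Real.exp (t * (‖p.1‖ + ‖p.2‖))) := by
        gcongr
        · refine (hfexp _).trans ?_
          gcongr
          linarith [norm_nonneg p.1]
        · exact hexp_le _ _ (hn1 θ p)
      _ = _ := by
        generalize ‖p.1‖ + ‖p.2‖ = N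
        rw [add_mul t, Real.exp_add, one_mul, hC₀]
        ring
  have hF'_le (θ : ℝ) (p : E × E) :
      ‖F' θ p‖ ≤ C₀ * t * Real.exp ((t + 2) * (‖p.1‖ + ‖p.2‖)) := by
    have h1 : |fderiv ℝ f (R θ p).1 (R θ p).2| ≤ Real.exp (‖p.1‖ + ‖p.2‖) := by
      refine ((fderiv ℝ f (R θ p).1).le_of_opNorm_le (hfd_le _) _).trans ?_
      rw [one_mul]
      refine (hn2 θ p).trans ?_
      linarith [Real.add_one_le_exp (‖p.1‖ + ‖p.2‖)]
    calc ‖F' θ p‖ = ‖F θ p‖ * (t * |fderiv ℝ f (R θ p).1 (R θ p).2|) := by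
          simp [hF, hF', abs_of_nonneg ht]
          ring
      _ ≤ (C₀ * Real.exp ((t + 1) * (‖p.1‖ + ‖p.2‖))) * (t * Real.exp (‖p.1‖ + ‖p.2‖)) := by
        gcongr
        exact hF_le θ p
      _ = _ := by
        generalize ‖p.1‖ + ‖p.2‖ = N
        rw [show (t + 2) * N = (t + 1) * N + N by ring, Real.exp_add]
        ring
  have hFc (θ : ℝ) : Continuous (F θ) := by fun_prop
  have hF'c (θ : ℝ) : Continuous (F' θ) := by fun_prop
  have hFi (θ : ℝ) : Integrable (F θ) (μ.prod μ) :=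
    ((integrable_exp_mul_norm_add_norm μ (t + 1)).const_mul C₀).mono'
      (hFc θ).aestronglyMeasurable (ae_of_all _ (hF_le θ))
  have hF'i (θ : ℝ) : Integrable (F' θ) (μ.prod μ) :=
    ((integrable_exp_mul_norm_add_norm μ (t + 2)).const_mul (C₀ * t)).mono'
      (hF'c θ).aestronglyMeasurable (ae_of_all _ (hF'_le θ))
  have hΦ (θ : ℝ) : HasDerivAt (fun θ ↦ ∫ p, F θ p ∂(μ.prod μ)) (∫ p, F' θ p ∂(μ.prod μ)) θ :=
    (hasDerivAt_integral_of_dominated_loc_of_deriv_le (s := Set.univ) Filter.univ_mem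
      (Filter.Eventually.of_forall fun θ ↦ (hFc θ).aestronglyMeasurable) (hFi θ)
      (hF'c θ).aestronglyMeasurable (ae_of_all _ fun p θ _ ↦ hF'_le θ p)
      ((integrable_exp_mul_norm_add_norm μ (t + 2)).const_mul (C₀ * t))
      (ae_of_all _ fun p θ _ ↦ hFd θ p)).2
  have hexpi := hf.integrable_exp_mul_of_isGaussian μ t
  have hΦ'_le (θ : ℝ) (hθ : 0 ≤ Real.cos θ) :
      ∫ p, F' θ p ∂(μ.prod μ) ≤ Real.cos θ * (t * L * M) := by
    set G : E × E → ℝ := fun p ↦ f (Real.sin θ • p.1 + Real.cos θ • p.2)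
      * (Real.exp (t * f p.1) * (t * fderiv ℝ f p.1 p.2)) with hG
    have hGc : Continuous G := by fun_prop
    have hGR (p : E × E) : F' θ p = G (R θ p) := by
      have : Real.sin θ • (R θ p).1 + Real.cos θ • (R θ p).2 = p.2 := by
        rw [hR1, hR2]
        have := Real.sin_sq_add_cos_sq θ
        calc _ = (Real.sin θ ^ 2 + Real.cos θ ^ 2) • p.2 := by module
          _ = p.2 := by rw [this, one_smul]
      simp only [hF', hG, this]
    have hGi : Integrable G (μ.prod μ) := by
      rw [← hRμ θ, integrable_map_measure hGc.aestronglyMeasurable (by fun_prop)]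
      exact (hF'i θ).congr (ae_of_all _ hGR)
    have hFG : ∫ p, F' θ p ∂(μ.prod μ) = ∫ p, G p ∂(μ.prod μ) := by
      conv_rhs => rw [← hRμ θ]
      rw [integral_map (by fun_prop) hGc.aestronglyMeasurable]
      simp_rw [hGR]
    rw [hFG, integral_prod _ hGi]
    have hM' : Real.cos θ * (t * L * M)
        = ∫ x, Real.cos θ * (t * L) * Real.exp (t * f x) ∂μ := by
      rw [integral_const_mul, ← hM]
      ring
    rw [hM']
    refine integral_mono hGi.integral_prod_left (hexpi.const_mul _) fun u ↦ ?_
    have hk : LipschitzWith (Real.cos θ).toNNReal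
        (fun v ↦ f (Real.sin θ • u + Real.cos θ • v)) := by
      refine LipschitzWith.of_dist_le_mul fun v w ↦ ?_
      refine (hf.dist_le_mul _ _).trans ?_
      rw [dist_add_left, dist_smul₀, Real.coe_toNNReal _ hθ, Real.norm_of_nonneg hθ]
      simp
    have h1 := integral_lipschitz_mul_dual_le hμ hk (fderiv ℝ f u)
    rw [Real.coe_toNNReal _ hθ] at h1
    have h2 : L * ‖fderiv ℝ f u‖ ≤ L := mul_le_of_le_one_right L.coe_nonneg (hfd_le u)
    calc ∫ v, G (u, v) ∂μ = t * Real.exp (t * f u)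
          * ∫ v, f (Real.sin θ • u + Real.cos θ • v) * fderiv ℝ f u v ∂μ := by
          rw [← integral_const_mul]
          congr 1 with v
          simp only [hG]
          ring
      _ ≤ t * Real.exp (t * f u) * (Real.cos θ * L) := by
        gcongr
        refine h1.trans ?_
        gcongr
        exact (hL _).trans h2
      _ = _ := by ring
  have hanti : AntitoneOn (fun θ ↦ ∫ p, F θ p ∂(μ.prod μ) - Real.sin θ * (t * L * M))
      (Set.Icc 0 (Real.pi / 2)) := by
    have hder (θ : ℝ) := (hΦ θ).sub ((Real.hasDerivAt_sin θ).mul_const (t * L * M))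
    refine antitoneOn_of_hasDerivWithinAt_nonpos (convex_Icc _ _)
      (fun θ _ ↦ (hder θ).continuousAt.continuousWithinAt)
      (fun θ _ ↦ (hder θ).hasDerivWithinAt) fun θ hθ ↦ ?_
    rw [interior_Icc] at hθ
    have := hΦ'_le θ (Real.cos_nonneg_of_mem_Icc ⟨by linarith [hθ.1, Real.pi_pos], hθ.2.le⟩)
    linarith
  have h0 : ∫ p, F 0 p ∂(μ.prod μ) = (∫ x, f x ∂μ) * M := by
    simp only [hF, hR1, Real.cos_zero, Real.sin_zero, one_smul, zero_smul, add_zero]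
    simp_rw [mul_comm (f _)]
    rw [integral_prod_mul (fun x ↦ Real.exp (t * f x)) f, mul_comm]
  have h1 : ∫ p, F (Real.pi / 2) p ∂(μ.prod μ) = ∫ x, f x * Real.exp (t * f x) ∂μ := by
    simp only [hF, hR1, Real.cos_pi_div_two, Real.sin_pi_div_two, one_smul, zero_smul, zero_add]
    have := integral_prod_mul (μ := μ) (ν := μ) (fun _ ↦ (1 : ℝ))
      (fun x ↦ f x * Real.exp (t * f x))
    simpa using this
  have := hanti (Set.left_mem_Icc.2 (by positivity)) (Set.right_mem_Icc.2 (by positivity))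
    (by positivity)
  simp only [h0, h1, Real.sin_zero, Real.sin_pi_div_two] at this
  linarith

lemma mgf_lipschitz_le (hμ : μ[id] = 0) {L : NNReal}
    (hL : ∀ ℓ : StrongDual ℝ E, ‖∫ x, ℓ x • x ∂μ‖ ≤ L * ‖ℓ‖) {f : E → ℝ}
    (hf : LipschitzWith 1 f) (hd : ContDiff ℝ 1 f) {t : ℝ} (ht : 0 ≤ t) :
    mgf f μ t ≤ Real.exp (t * ∫ x, f x ∂μ + L * t ^ 2 / 2) := by
  set m := ∫ x, f x ∂μ with hm
  have hset : integrableExpSet f μ = Set.univ :=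
    Set.eq_univ_of_forall fun t ↦ hf.integrable_exp_mul_of_isGaussian μ t
  have hder (t : ℝ) : HasDerivAt (fun t ↦ mgf f μ t * Real.exp (-(t * m + L * t ^ 2 / 2)))
      ((∫ x, f x * Real.exp (t * f x) ∂μ - m * mgf f μ t - t * L * mgf f μ t)
        * Real.exp (-(t * m + L * t ^ 2 / 2))) t := by
    have h1 : HasDerivAt (mgf f μ) (∫ x, f x * Real.exp (t * f x) ∂μ) t :=
      hasDerivAt_mgf (by simp [hset])
    have h2 : HasDerivAt (fun t : ℝ ↦ -(t * m + L * t ^ 2 / 2)) (-(m + L * t)) t := by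
      have := (((hasDerivAt_id t).mul_const m).add
        ((((hasDerivAt_id t).pow 2).const_mul (L : ℝ)).div_const 2)).neg
      convert! this using 1
      simp
      ring
    convert! h1.mul h2.exp using 1
    ring
  have hanti : AntitoneOn (fun t ↦ mgf f μ t * Real.exp (-(t * m + L * t ^ 2 / 2)))
      (Set.Ici 0) := by
    refine antitoneOn_of_hasDerivWithinAt_nonpos (convex_Ici _)
      (fun t _ ↦ (hder t).continuousAt.continuousWithinAt)
      (fun t _ ↦ (hder t).hasDerivWithinAt) fun t ht ↦ ?_
    rw [interior_Ici] at ht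
    refine mul_nonpos_of_nonpos_of_nonneg ?_ (Real.exp_pos _).le
    have := integral_mul_exp_sub_le hμ hL hf hd (le_of_lt ht)
    simp only [mgf]
    linarith
  have := hanti Set.self_mem_Ici ht ht
  simp only [mgf_zero, Real.exp_neg] at this
  rw [← div_eq_mul_inv, div_le_iff₀ (Real.exp_pos _)] at this
  simpa using this

/-- Smooth `1`-Lipschitz functions of a centered Gaussian vector are sub-Gaussian, with parameter
the operator norm of the covariance. -/
lemma hasSubgaussianMGF_lipschitz_sub_integral (hμ : μ[id] = 0) {L : NNReal}
    (hL : ∀ ℓ : StrongDual ℝ E, ‖∫ x, ℓ x • x ∂μ‖ ≤ L * ‖ℓ‖) {f : E → ℝ}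
    (hf : LipschitzWith 1 f) (hd : ContDiff ℝ 1 f) :
    HasSubgaussianMGF (fun x ↦ f x - ∫ y, f y ∂μ) L μ where
  integrable_exp_mul t :=
    LipschitzWith.integrable_exp_mul_of_isGaussian μ (by simpa using hf.sub (.const _)) t
  mgf_le t := by
    have hmgf : mgf (fun x ↦ f x - ∫ y, f y ∂μ) μ t
        = mgf f μ t * Real.exp (-(t * ∫ y, f y ∂μ)) := by
      rw [mgf, mgf, ← integral_mul_const]
      simp_rw [← Real.exp_add]
      congr with x
      ring_nf
    have key : mgf f μ t ≤ Real.exp (t * ∫ x, f x ∂μ + L * t ^ 2 / 2) := by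
      rcases le_total 0 t with ht | ht
      · exact mgf_lipschitz_le hμ hL hf hd ht
      · have := mgf_lipschitz_le hμ hL hf.neg hd.neg (neg_nonneg.2 ht)
        rw [mgf_neg, neg_neg] at this
        simpa [integral_neg] using this
    rw [hmgf, Real.exp_neg, ← div_eq_mul_inv, div_le_iff₀ (Real.exp_pos _), ← Real.exp_add]
    rwa [add_comm] at key

lemma measure_abs_lipschitz_sub_integral_ge_le (hμ : μ[id] = 0) {L : NNReal}
    (hL : ∀ ℓ : StrongDual ℝ E, ‖∫ x, ℓ x • x ∂μ‖ ≤ L * ‖ℓ‖) {f : E → ℝ}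
    (hf : LipschitzWith 1 f) (hd : ContDiff ℝ 1 f) {h : ℝ} (hh : 0 ≤ h) :
    μ.real {x | h ≤ |f x - ∫ y, f y ∂μ|} ≤ 2 * Real.exp (-h ^ 2 / (2 * L)) := by
  have hsub := hasSubgaussianMGF_lipschitz_sub_integral hμ hL hf hd
  have h1 := hsub.measure_ge_le hh
  have h2 := hsub.neg.measure_ge_le hh
  have hU : {x | h ≤ |f x - ∫ y, f y ∂μ|} = {x | h ≤ f x - ∫ y, f y ∂μ}
      ∪ {x | h ≤ (-fun x ↦ f x - ∫ y, f y ∂μ) x} := by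
    ext x
    simp [le_abs]
  rw [hU]
  refine (measureReal_union_le _ _).trans ?_
  linarith

end GaussianMeasure

section SmoothNorm

lemma sqrt_add_sq_le_sqrt_add_sq_add_abs {c : ℝ} (hc : 0 ≤ c) (a b : ℝ) :
    √(c + a ^ 2) ≤ √(c + b ^ 2) + |a - b| := by
  have h1 : |b| ≤ √(c + b ^ 2) := Real.abs_le_sqrt (by linarith)
  have h2 : √(c + b ^ 2) ^ 2 = c + b ^ 2 := Real.sq_sqrt (by positivity)
  refine Real.sqrt_le_iff.2 ⟨by positivity, ?_⟩
  have h3 : b * (a - b) ≤ √(c + b ^ 2) * |a - b| :=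
    (le_abs_self _).trans (by rw [abs_mul]; gcongr)
  nlinarith [sq_abs (a - b)]

variable {E : Type*} [NormedAddCommGroup E]

lemma lipschitzWith_sqrt_add_norm_sq {c : ℝ} (hc : 0 ≤ c) :
    LipschitzWith 1 (fun x : E ↦ √(c + ‖x‖ ^ 2)) :=
  LipschitzWith.of_le_add fun x y ↦
    (sqrt_add_sq_le_sqrt_add_sq_add_abs hc _ _).trans
      (add_le_add le_rfl ((abs_norm_sub_norm_le x y).trans_eq (dist_eq_norm x y).symm))

lemma norm_le_sqrt_sq_add_norm_sq (ε : ℝ) (x : E) : ‖x‖ ≤ √(ε ^ 2 + ‖x‖ ^ 2) :=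
  Real.le_sqrt_of_sq_le (by nlinarith [sq_nonneg ε])

lemma sqrt_sq_add_norm_sq_le {ε : ℝ} (hε : 0 ≤ ε) (x : E) :
    √(ε ^ 2 + ‖x‖ ^ 2) ≤ ε + ‖x‖ :=
  Real.sqrt_le_iff.2 ⟨by positivity, by nlinarith [mul_nonneg hε (norm_nonneg x)]⟩

lemma contDiff_sqrt_add_norm_sq [InnerProductSpace ℝ E] {c : ℝ} (hc : 0 < c) :
    ContDiff ℝ 1 (fun x : E ↦ √(c + ‖x‖ ^ 2)) :=
  (contDiff_const.add (contDiff_norm_sq ℝ)).sqrt fun x ↦ by positivity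

/-- **Gaussian concentration of the norm** on a Hilbert space. -/
lemma measure_abs_norm_sub_integral_ge_le [InnerProductSpace ℝ E] [CompleteSpace E]
    [SecondCountableTopology E] [MeasurableSpace E] [BorelSpace E] {μ : Measure E} [IsGaussian μ]
    (hμ : μ[id] = 0) {L : NNReal} (hL : ∀ ℓ : StrongDual ℝ E, ‖∫ x, ℓ x • x ∂μ‖ ≤ L * ‖ℓ‖)
    {h : ℝ} (hh : 0 < h) :
    μ.real {x | h ≤ |‖x‖ - ∫ y, ‖y‖ ∂μ|} ≤ 2 * Real.exp (-h ^ 2 / (2 * L)) := by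
  have hni : Integrable (fun x : E ↦ ‖x‖) μ := IsGaussian.integrable_id.norm
  have hε {ε : ℝ} (hε : ε ∈ Set.Ioo 0 h) :
      μ.real {x | h ≤ |‖x‖ - ∫ y, ‖y‖ ∂μ|} ≤ 2 * Real.exp (-(h - ε) ^ 2 / (2 * L)) := by
    have hlip := lipschitzWith_sqrt_add_norm_sq (E := E) (sq_nonneg ε)
    have hfi : Integrable (fun x : E ↦ √(ε ^ 2 + ‖x‖ ^ 2)) μ :=
      (hlip.memLp_two_of_isGaussian μ).integrable (by norm_num)
    refine le_trans (measureReal_mono fun x hx ↦ ?_)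
      (measure_abs_lipschitz_sub_integral_ge_le hμ hL hlip
        (contDiff_sqrt_add_norm_sq (pow_pos hε.1 2)) (sub_nonneg.2 hε.2.le))
    have h1 : ∫ y, ‖y‖ ∂μ ≤ ∫ y, √(ε ^ 2 + ‖y‖ ^ 2) ∂μ :=
      integral_mono hni hfi fun y ↦ norm_le_sqrt_sq_add_norm_sq ε y
    have h2 : ∫ y, √(ε ^ 2 + ‖y‖ ^ 2) ∂μ ≤ ε + ∫ y, ‖y‖ ∂μ := by
      have : ∫ y, (ε + ‖y‖) ∂μ = ε + ∫ y, ‖y‖ ∂μ := by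
        rw [integral_add (integrable_const _) hni]
        simp
      rw [← this]
      exact integral_mono hfi ((integrable_const _).add hni)
        fun y ↦ sqrt_sq_add_norm_sq_le hε.1.le y
    have h3 := norm_le_sqrt_sq_add_norm_sq ε x
    have h4 := sqrt_sq_add_norm_sq_le hε.1.le x
    simp only [Set.mem_ofPred_eq, le_abs] at hx ⊢
    rcases hx with hx | hx
    · left; linarith
    · right; linarith
  have hlim : Filter.Tendsto (fun ε : ℝ ↦ 2 * Real.exp (-(h - ε) ^ 2 / (2 * L)))
      (nhdsWithin 0 (Set.Ioi 0)) (nhds (2 * Real.exp (-h ^ 2 / (2 * L)))) := by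
    have : Continuous fun ε : ℝ ↦ 2 * Real.exp (-(h - ε) ^ 2 / (2 * L)) := by fun_prop
    simpa using (this.tendsto 0).mono_left nhdsWithin_le_nhds
  exact ge_of_tendsto hlim (Filter.eventually_of_mem (Ioo_mem_nhdsGT hh) fun ε ↦ hε)

end SmoothNorm

section EuclideanNorm

variable {n : ℕ}

lemma euclNorm_eq_norm (v : Fin n → ℝ) : euclNorm v = ‖WithLp.toLp 2 v‖ := by
  simp [euclNorm, EuclideanSpace.norm_eq]

lemma specNorm_nonneg (Γ : Matrix (Fin n) (Fin n) ℝ) : 0 ≤ specNorm Γ := by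
  refine Real.sSup_nonneg ?_
  rintro r ⟨v, -, rfl⟩
  exact Real.sqrt_nonneg _

lemma norm_mulVec_le_specNorm_mul (Γ : Matrix (Fin n) (Fin n) ℝ) (v : Fin n → ℝ) :
    ‖WithLp.toLp 2 (Γ.mulVec v)‖ ≤ specNorm Γ * ‖WithLp.toLp 2 v‖ := by
  have hbdd : BddAbove {r : ℝ | ∃ v : Fin n → ℝ, euclNorm v = 1 ∧ r = euclNorm (Γ.mulVec v)} := by
    refine ⟨‖Matrix.toEuclideanCLM (𝕜 := ℝ) Γ‖, ?_⟩
    rintro r ⟨v, hv, rfl⟩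
    rw [euclNorm_eq_norm] at hv ⊢
    have := (Matrix.toEuclideanCLM (𝕜 := ℝ) Γ).le_opNorm (WithLp.toLp 2 v)
    rwa [hv, mul_one, Matrix.toEuclideanCLM_toLp] at this
  rcases eq_or_ne (WithLp.toLp 2 v) 0 with hv | hv
  · have : v = 0 := by simpa using hv
    simp [this]
  have hv' : 0 < ‖WithLp.toLp 2 v‖ := norm_pos_iff.2 hv
  have := le_csSup hbdd ⟨‖WithLp.toLp 2 v‖⁻¹ • v, by
    rw [euclNorm_eq_norm, WithLp.toLp_smul, norm_smul, norm_inv, norm_norm,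
      inv_mul_cancel₀ hv'.ne'], rfl⟩
  rw [euclNorm_eq_norm, Matrix.mulVec_smul, WithLp.toLp_smul, norm_smul, norm_inv, norm_norm,
    inv_mul_le_iff₀ hv'] at this
  rw [mul_comm]
  exact this

lemma dual_toLp_eq_sum (ℓ : StrongDual ℝ (EuclideanSpace ℝ (Fin n))) (v : Fin n → ℝ) :
    ℓ (WithLp.toLp 2 v) = ∑ i, ℓ (EuclideanSpace.single i 1) * v i := by
  conv_lhs => rw [← (EuclideanSpace.basisFun (Fin n) ℝ).sum_repr (WithLp.toLp 2 v)]
  simp [map_sum, mul_comm]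

lemma norm_toLp_dual_single (ℓ : StrongDual ℝ (EuclideanSpace ℝ (Fin n))) :
    ‖WithLp.toLp 2 fun i ↦ ℓ (EuclideanSpace.single i 1)‖ = ‖ℓ‖ := by
  rw [← (InnerProductSpace.toDual ℝ (EuclideanSpace ℝ (Fin n))).norm_map]
  congr 1
  ext x
  have := dual_toLp_eq_sum ℓ x.ofLp
  simp only [WithLp.toLp_ofLp] at this
  rw [this, InnerProductSpace.toDual_apply_apply, PiLp.inner_apply]
  simp [mul_comm]

variable {Ω : Type*} [MeasurableSpace Ω] {P : Measure Ω} {Y : Fin n → Ω → ℝ}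

lemma IsCenteredGaussianVector.exists_map_dual_eq (hY : ∀ i, Measurable (Y i))
    (hG : IsCenteredGaussianVector P Y) (ℓ : StrongDual ℝ (EuclideanSpace ℝ (Fin n))) :
    ∃ v : NNReal, (P.map fun ω ↦ WithLp.toLp 2 fun i ↦ Y i ω).map ℓ = gaussianReal 0 v := by
  obtain ⟨v, hv⟩ := hG fun i ↦ ℓ (EuclideanSpace.single i 1)
  refine ⟨v, ?_⟩
  rw [Measure.map_map (by fun_prop) (by fun_prop), ← hv]
  exact congrArg (fun g ↦ P.map g) (funext fun ω ↦ dual_toLp_eq_sum ℓ _)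

lemma IsCenteredGaussianVector.isGaussian_map (hY : ∀ i, Measurable (Y i))
    (hG : IsCenteredGaussianVector P Y) :
    IsGaussian (P.map fun ω ↦ WithLp.toLp 2 fun i ↦ Y i ω) :=
  isGaussian_of_map_eq_gaussianReal fun ℓ ↦ ⟨0, hG.exists_map_dual_eq hY ℓ⟩

lemma IsCenteredGaussianVector.integral_id_map_eq_zero (hY : ∀ i, Measurable (Y i))
    (hG : IsCenteredGaussianVector P Y) :
    ∫ x, id x ∂(P.map fun ω ↦ WithLp.toLp 2 fun i ↦ Y i ω) = 0 := by
  have := hG.isGaussian_map hY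
  refine SeparatingDual.eq_zero_of_forall_dual_eq_zero (R := ℝ) fun ℓ ↦ ?_
  obtain ⟨v, hv⟩ := hG.exists_map_dual_eq hY ℓ
  simp only [id_eq]
  rw [← IsGaussian.integral_dual,
    ← integral_map (φ := ℓ) (f := fun x ↦ x) (by fun_prop) (by fun_prop), hv]
  exact integral_id_gaussianReal

lemma IsCenteredGaussianVector.norm_integral_dual_smul_le (hY : ∀ i, Measurable (Y i))
    (hG : IsCenteredGaussianVector P Y) {Γ : Matrix (Fin n) (Fin n) ℝ}
    (hΓ : ∀ i j, Γ i j = ∫ ω, Y i ω * Y j ω ∂P) (ℓ : StrongDual ℝ (EuclideanSpace ℝ (Fin n))) :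
    ‖∫ x, ℓ x • x ∂(P.map fun ω ↦ WithLp.toLp 2 fun i ↦ Y i ω)‖ ≤ specNorm Γ * ‖ℓ‖ := by
  have := hG.isGaussian_map hY
  set μ := P.map fun ω ↦ WithLp.toLp 2 fun i ↦ Y i ω with hμ
  have hcoord (i j : Fin n) : Integrable (fun x : EuclideanSpace ℝ (Fin n) ↦ x i * x j) μ :=
    integrable_dual_mul_dual (EuclideanSpace.proj i) (EuclideanSpace.proj j)
  have hcov (i j : Fin n) : ∫ x : EuclideanSpace ℝ (Fin n), x i * x j ∂μ = Γ i j := by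
    rw [hμ, integral_map (by fun_prop) (by fun_prop), hΓ]
  have hint : Integrable (fun x ↦ ℓ x • x) μ :=
    memLp_one_iff_integrable.1
      ((IsGaussian.memLp_two_id (μ := μ)).smul (IsGaussian.memLp_dual μ ℓ 2 (by simp)))
  have : ∫ x, ℓ x • x ∂μ
      = WithLp.toLp 2 (Γ.mulVec fun i ↦ ℓ (EuclideanSpace.single i 1)) := by
    ext i
    have h1 : ∫ x, ℓ x * x i ∂μ = (∫ x, ℓ x • x ∂μ) i :=
      (EuclideanSpace.proj (𝕜 := ℝ) i).integral_comp_comm hint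
    rw [← h1]
    have h2 (x : EuclideanSpace ℝ (Fin n)) :
        ℓ x * x i = ∑ j, ℓ (EuclideanSpace.single j 1) * (x i * x j) := by
      rw [show ℓ x = _ from dual_toLp_eq_sum ℓ x.ofLp, Finset.sum_mul]
      exact Finset.sum_congr rfl fun j _ ↦ by ring
    simp_rw [h2]
    rw [integral_finsetSum _ fun j _ ↦ (hcoord i j).const_mul _]
    simp_rw [integral_const_mul, hcov]
    simp [Matrix.mulVec, dotProduct, mul_comm]
  rw [this, ← norm_toLp_dual_single]
  exact norm_mulVec_le_specNorm_mul _ _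

end EuclideanNorm

/-- **Concentration of the Euclidean norm of a Gaussian vector (Corollary 1).**
There is a universal constant `C > 0` such that for every `n ≥ 1`, every
centered Gaussian vector `Y` in `ℝⁿ` with covariance matrix `Γ` and every
`h > 0`, `P(|‖Y‖₂ − E‖Y‖₂| ≥ h) ≤ C·exp(−h²/(2‖Γ‖₂))`. -/
theorem gaussian_vector_norm_concentration :
    ∃ C : ℝ, 0 < C ∧
      ∀ (n : ℕ), 1 ≤ n →
      ∀ (Ω : Type) (_ : MeasurableSpace Ω) (P : Measure Ω), IsProbabilityMeasure P →
      ∀ (Y : Fin n → Ω → ℝ), (∀ i, Measurable (Y i)) →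
        IsCenteredGaussianVector P Y →
        ∀ (Γ : Matrix (Fin n) (Fin n) ℝ),
          (∀ i j, Γ i j = ∫ ω, Y i ω * Y j ω ∂P) →
        ∀ h : ℝ, 0 < h →
          P {ω | |euclNorm (fun i => Y i ω) -
                    ∫ ω', euclNorm (fun i => Y i ω') ∂P| ≥ h}
            ≤ ENNReal.ofReal (C * Real.exp (-(h ^ 2 / (2 * specNorm Γ)))) := by
  refine ⟨2, two_pos, fun n _ Ω _ P _ Y hY hG Γ hΓ h hh ↦ ?_⟩
  have := hG.isGaussian_map hY
  have hm : Measurable fun ω ↦ WithLp.toLp 2 fun i ↦ Y i ω := by fun_prop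
  have key := measure_abs_norm_sub_integral_ge_le (hG.integral_id_map_eq_zero hY)
    (L := ⟨specNorm Γ, specNorm_nonneg Γ⟩) (hG.norm_integral_dual_smul_le hY hΓ) hh
  rw [map_measureReal_apply hm (measurableSet_le (by fun_prop) (by fun_prop)),
    integral_map hm.aemeasurable (by fun_prop)] at key
  rw [← ofReal_measureReal]
  refine ENNReal.ofReal_le_ofReal ?_
  simp_rw [euclNorm_eq_norm, ← neg_div]
  exact key
end

section
/- Let H ∈ (1/2, 1) and β ∈ [H, 1), and let X ∈ 𝒳^{(H,β)} on [0,T]. Let δ > 0 and N ∈ ℕ with δ·N < T, set Y_k = X_{kδ} − X_{(k−1)δ} for k = 1, …, N, Y = (Y_1, …, Y_N), and I = (Σ_{k=1}^N E[(X_{kδ} − X_{(k−1)δ})²])^{1/2}. Then there exist constants C_1, C_2 > 0, independent of δ, N and T, such that for every h > 0, P( | ‖Y‖_2 − I | ≥ h ) ≤ C_1·exp( − C_2 · N·h² / (δN)^{2H} ), where ‖Y‖_2 is the Euclidean norm of Y. -/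
open MeasureTheory ProbabilityTheory

/-- The class `𝒳^{(H,β)}` of centered Gaussian processes on `[0,T]` with
`X_0 = 0`, whose incremental variance function `σ²(s,t) = E[(X_t − X_s)²]` is
differentiable for `s ≠ t` with mixed partial derivative bounded by
`c·|t−s|^{2H−2}` and satisfies `c·|t−s|^{2β} ≤ σ²(s,t) ≤ C·|t−s|^{2H}`. -/
def IsClassX (H β c C T : ℝ) {Ω : Type*} [MeasurableSpace Ω] (P : Measure Ω)
    (X : Ω → ℝ → ℝ) : Prop :=
  (∀ t, Measurable fun ω => X ω t) ∧
  (∀ᵐ ω ∂P, X ω 0 = 0) ∧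
  -- centered Gaussian process
  (∀ (n : ℕ) (t coef : Fin n → ℝ), (∀ i, t i ∈ Set.Icc 0 T) →
    ∃ v : NNReal,
      Measure.map (fun ω => ∑ i, coef i * X ω (t i)) P = gaussianReal 0 v) ∧
  -- σ² is C¹ for s ≠ t with mixed partial derivative bounded by c|t−s|^{2H−2}
  (∃ σ2t σ2st : ℝ → ℝ → ℝ,
    (∀ s t : ℝ, s ∈ Set.Icc 0 T → t ∈ Set.Icc 0 T → s ≠ t →
      HasDerivAt (fun u => ∫ ω, (X ω u - X ω s) ^ 2 ∂P) (σ2t s t) t) ∧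
    (∀ s t : ℝ, s ∈ Set.Icc 0 T → t ∈ Set.Icc 0 T → s ≠ t →
      HasDerivAt (fun u => σ2t u t) (σ2st s t) s) ∧
    (∀ s t : ℝ, s ∈ Set.Icc 0 T → t ∈ Set.Icc 0 T → s ≠ t →
      |σ2st s t| ≤ c * |t - s| ^ (2 * H - 2))) ∧
  -- two-sided bound on the incremental variance
  (∀ s t : ℝ, s ∈ Set.Icc 0 T → t ∈ Set.Icc 0 T →
    c * |t - s| ^ (2 * β) ≤ (∫ ω, (X ω t - X ω s) ^ 2 ∂P) ∧
    (∫ ω, (X ω t - X ω s) ^ 2 ∂P) ≤ C * |t - s| ^ (2 * H))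

lemma one_sub_inv_le_exp {y : ℝ} (hy : y ≤ 1 / 2) : (1 - y)⁻¹ ≤ Real.exp (y + y ^ 2) := by
  rw [inv_le_iff_one_le_mul₀' (by linarith)]
  rcases le_total y 0 with h | h
  · have h1 := Real.add_one_le_exp (y + y ^ 2)
    have h2 := mul_le_mul_of_nonneg_left h1 (by linarith : (0 : ℝ) ≤ 1 - y)
    nlinarith [mul_nonneg (neg_nonneg.2 h) (sq_nonneg y)]
  · have h1 := Real.quadratic_le_exp_of_nonneg (by positivity : 0 ≤ y + y ^ 2)
    have h2 := mul_le_mul_of_nonneg_left h1 (by linarith : (0 : ℝ) ≤ 1 - y)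
    have h3 : 0 ≤ y ^ 2 * ((1 - y) * (1 + y) ^ 2 - 2 * y) := by
      apply mul_nonneg (sq_nonneg y)
      nlinarith [mul_nonneg h (by linarith : 0 ≤ 1 / 2 - y), sq_nonneg y,
        mul_nonneg (mul_nonneg h h) (by linarith : 0 ≤ 1 / 2 - y)]
    nlinarith

lemma integrable_exp_mul_sq_gaussianReal (v : NNReal) {t : ℝ} (ht : t * v ≤ 1 / 4) :
    Integrable (fun x ↦ Real.exp (t * x ^ 2)) (gaussianReal 0 v) := by
  by_cases hv : v = 0
  · simp only [hv, gaussianReal_zero_var]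
    exact integrable_dirac (by simp)
  have hv' : (0 : ℝ) < v := by positivity
  rw [gaussianReal_of_var_ne_zero _ hv, integrable_withDensity_iff_integrable_smul'
    (measurable_gaussianPDF _ _) (ae_of_all _ fun _ ↦ gaussianPDF_lt_top)]
  have hb : 0 < 1 / (2 * (v : ℝ)) - t := by
    rw [sub_pos, lt_div_iff₀ (by positivity)]
    linarith
  refine ((integrable_exp_neg_mul_sq hb).const_mul (√(2 * Real.pi * v))⁻¹).congr
    (ae_of_all _ fun x ↦ ?_)
  simp only [toReal_gaussianPDF, gaussianPDFReal, smul_eq_mul, mul_assoc, ← Real.exp_add]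
  congr 3
  field_simp
  ring

lemma integral_exp_mul_sq_gaussianReal_le (v : NNReal) {t : ℝ} (ht : t * v ≤ 1 / 4) :
    ∫ x, Real.exp (t * x ^ 2) ∂(gaussianReal 0 v) ≤ Real.exp (t * v + 2 * t ^ 2 * v ^ 2) := by
  by_cases hv : v = 0
  · simp [hv, gaussianReal_zero_var]
  have hv' : (0 : ℝ) < v := by positivity
  have hpos : 0 < 1 - 2 * t * v := by linarith
  have key : ∫ x, Real.exp (t * x ^ 2) ∂(gaussianReal 0 v) = √((1 - 2 * t * v)⁻¹) := by
    rw [integral_gaussianReal_eq_integral_smul hv]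
    have : ∀ x : ℝ, gaussianPDFReal 0 v x • Real.exp (t * x ^ 2)
        = (√(2 * Real.pi * v))⁻¹ * Real.exp (-(1 / (2 * (v : ℝ)) - t) * x ^ 2) := fun x ↦ by
      simp only [gaussianPDFReal, smul_eq_mul, mul_assoc, ← Real.exp_add]
      congr 3
      field_simp
      ring
    simp_rw [this]
    rw [integral_const_mul, integral_gaussian, ← Real.sqrt_inv, ← Real.sqrt_mul (by positivity)]
    congr 1
    have := Real.pi_pos
    have h3 : 1 / (2 * (v : ℝ)) - t = (1 - 2 * t * v) / (2 * v) := by field_simp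
    rw [h3]
    field_simp
  rw [key, Real.sqrt_le_left (Real.exp_pos _).le, ← Real.exp_nat_mul]
  refine (one_sub_inv_le_exp (by linarith)).trans_eq ?_
  congr 1
  push_cast
  ring

section GaussianVector

variable {Ω ι : Type*} [MeasurableSpace Ω] {P : Measure Ω} [Fintype ι]

/-- Principal components of a centered Gaussian vector. -/
lemma ProbabilityTheory.HasGaussianLaw.exists_iIndepFun_sum_sq_eq
    {Y : ι → Ω → ℝ} (hY : HasGaussianLaw (fun ω ↦ (Y · ω)) P) (h0 : ∀ i, ∫ ω, Y i ω ∂P = 0)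
    {l : ℝ} (hl : ∀ i, ∑ j, |∫ ω, Y i ω * Y j ω ∂P| ≤ l) :
    ∃ (Z : ι → Ω → ℝ) (v : ι → NNReal), iIndepFun Z P ∧
      (∀ i, AEMeasurable (Z i) P) ∧
      (∀ i, P.map (Z i) = gaussianReal 0 (v i)) ∧ (∀ i, (v i : ℝ) ≤ l) ∧
      (∑ i, (v i : ℝ) = ∑ i, ∫ ω, Y i ω ^ 2 ∂P) ∧
      ∀ ω, ∑ i, Z i ω ^ 2 = ∑ i, Y i ω ^ 2 := by
  classical
  have := hY.isProbabilityMeasure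
  have hm : ∀ i, MemLp (Y i) 2 P := fun i ↦ (hY.eval i).memLp_two
  let A : Matrix ι ι ℝ := fun i j ↦ ∫ ω, Y i ω * Y j ω ∂P
  have hA : A.IsHermitian := by
    refine Matrix.IsHermitian.ext fun i j ↦ ?_
    simp [A, mul_comm]
  let b := hA.eigenvectorBasis
  let Z : ι → Ω → ℝ := fun i ω ↦ ∑ j, b i j * Y j ω
  have hZ : HasGaussianLaw (fun ω ↦ (Z · ω)) P :=
    hY.map_fun (ContinuousLinearMap.pi fun i ↦ ∑ j, b i j • ContinuousLinearMap.proj j)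
      |>.congr (ae_of_all _ fun ω ↦ by ext i; simp [Z])
  have hmZ : ∀ i, MemLp (Z i) 2 P := fun i ↦ (hZ.eval i).memLp_two
  have hZ0 : ∀ i, ∫ ω, Z i ω ∂P = 0 := fun i ↦ by
    simp only [Z]
    rw [integral_finsetSum _ fun j _ ↦ ((hm j).integrable one_le_two).const_mul _]
    simp [integral_const_mul, h0]
  have horth : ∀ i k, ∑ j, b i j * b k j = if i = k then 1 else 0 := fun i k ↦ by
    have := orthonormal_iff_ite.1 b.orthonormal i k
    rw [← this, PiLp.inner_apply]
    simp [mul_comm]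
  have hAb : ∀ i j, ∑ m, A j m * b i m = hA.eigenvalues i * b i j := fun i j ↦ by
    have := congrFun (hA.mulVec_eigenvectorBasis i) j
    simpa [Matrix.mulVec, dotProduct] using this
  have hcov : ∀ i k, ∫ ω, Z i ω * Z k ω ∂P = if i = k then hA.eigenvalues i else 0 := fun i k ↦ by
    have h1 : ∀ ω, Z i ω * Z k ω = ∑ j, ∑ m, b i j * b k m * (Y j ω * Y m ω) := fun ω ↦ by
      simp only [Z, Finset.sum_mul_sum]
      exact Finset.sum_congr rfl fun _ _ ↦ Finset.sum_congr rfl fun _ _ ↦ by ring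
    have hint : ∀ j m, Integrable (fun ω ↦ b i j * b k m * (Y j ω * Y m ω)) P := fun j m ↦
      ((hm j).integrable_mul (hm m)).const_mul _
    simp_rw [h1]
    rw [integral_finsetSum _ fun j _ ↦ integrable_finsetSum _ fun m _ ↦ hint j m]
    simp_rw [fun j ↦ integral_finsetSum (μ := P) Finset.univ fun m _ ↦ hint j m,
      integral_const_mul]
    have h2 : ∀ j, ∑ m, b i j * b k m * ∫ ω, Y j ω * Y m ω ∂P
        = hA.eigenvalues k * (b i j * b k j) := fun j ↦ by
      rw [mul_left_comm, ← hAb k j, Finset.mul_sum]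
      exact Finset.sum_congr rfl fun m _ ↦ by simp only [A]; ring
    simp_rw [h2]
    rw [← Finset.mul_sum, horth]
    split_ifs with h <;> simp [h]
  have hvar : ∀ i, Var[Z i; P] = hA.eigenvalues i := fun i ↦ by
    rw [variance_of_integral_eq_zero (hZ.eval i).aemeasurable (hZ0 i)]
    simpa [sq] using hcov i i
  have hnn : ∀ i, 0 ≤ hA.eigenvalues i := fun i ↦ hvar i ▸ variance_nonneg _ _
  refine ⟨Z, fun i ↦ (hA.eigenvalues i).toNNReal, ?_, fun i ↦ (hZ.eval i).aemeasurable,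
    fun i ↦ ?_, fun i ↦ ?_, ?_, fun ω ↦ ?_⟩
  · refine hZ.iIndepFun_of_covariance_eq_zero fun i k hik ↦ ?_
    rw [covariance_eq_sub (hmZ i) (hmZ k), hZ0]
    simpa [hik] using hcov i k
  · rw [(hZ.eval i).map_eq_gaussianReal, hZ0, hvar]
  · rw [Real.coe_toNNReal _ (hnn i)]
    have hev : Module.End.HasEigenvalue (Matrix.toLin' A) (hA.eigenvalues i) := by
      refine Module.End.hasEigenvalue_of_hasEigenvector (x := ⇑(b i)) ⟨?_, fun h ↦ ?_⟩
      · rw [Module.End.mem_eigenspace_iff, Matrix.toLin'_apply]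
        exact hA.mulVec_eigenvectorBasis i
      · have := horth i i
        simp [h] at this
    obtain ⟨k, hk⟩ := eigenvalue_mem_ball hev
    rw [Metric.mem_closedBall, Real.dist_eq] at hk
    have h1 := hl k
    rw [← Finset.add_sum_erase _ _ (Finset.mem_univ k)] at h1
    have h2 := le_abs_self (hA.eigenvalues i - A k k)
    have h3 := le_abs_self (A k k)
    simp only [Real.norm_eq_abs, A] at *
    linarith
  · simp_rw [Real.coe_toNNReal _ (hnn _)]
    have := hA.trace_eq_sum_eigenvalues
    simp only [Matrix.trace, Matrix.diag, RCLike.ofReal_real_eq_id, id] at this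
    rw [← this]
    simp [A, sq]
  · have := b.sum_sq_norm_inner_right (WithLp.toLp 2 fun j ↦ Y j ω)
    rw [EuclideanSpace.norm_sq_eq] at this
    simpa [PiLp.inner_apply, Z, mul_comm] using this

lemma ProbabilityTheory.HasGaussianLaw.mgf_sum_sq_le
    {Y : ι → Ω → ℝ} (hY : HasGaussianLaw (fun ω ↦ (Y · ω)) P) (h0 : ∀ i, ∫ ω, Y i ω ∂P = 0)
    {l : ℝ} (hl : ∀ i, ∑ j, |∫ ω, Y i ω * Y j ω ∂P| ≤ l) {t : ℝ}
    (ht : t * l ≤ 1 / 4) :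
    Integrable (fun ω ↦ Real.exp (t * ∑ i, Y i ω ^ 2)) P ∧
    mgf (fun ω ↦ ∑ i, Y i ω ^ 2) P t ≤
      Real.exp ((t + 2 * t ^ 2 * l) * ∑ i, ∫ ω, Y i ω ^ 2 ∂P) := by
  have := hY.isProbabilityMeasure
  obtain ⟨Z, v, hind, hZm, hZ, hvl, hv, hsum⟩ := hY.exists_iIndepFun_sum_sq_eq h0 hl
  have htv : ∀ i, t * v i ≤ 1 / 4 := fun i ↦ by
    rcases le_total t 0 with h | h
    · have := mul_nonneg (neg_nonneg.2 h) (v i).2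
      simp only [NNReal.val_eq_coe] at this
      linarith
    · exact (mul_le_mul_of_nonneg_left (hvl i) h).trans ht
  have hind2 : iIndepFun (fun i ω ↦ Z i ω ^ 2) P :=
    hind.comp (fun _ x ↦ x ^ 2) fun _ ↦ by fun_prop
  have hi : ∀ i, Integrable (fun ω ↦ Real.exp (t * Z i ω ^ 2)) P := fun i ↦ by
    have := integrable_exp_mul_sq_gaussianReal (v i) (htv i)
    rw [← hZ i] at this
    exact this.comp_aemeasurable (hZm i)
  have hm : ∀ i, mgf (fun ω ↦ Z i ω ^ 2) P t ≤ Real.exp ((t + 2 * t ^ 2 * l) * v i) := fun i ↦ by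
    have h1 := integral_exp_mul_sq_gaussianReal_le (v i) (htv i)
    rw [← hZ i, integral_map (hZm i) (by fun_prop)] at h1
    refine h1.trans (Real.exp_le_exp.2 ?_)
    have := mul_le_mul_of_nonneg_left (hvl i) (by positivity : 0 ≤ 2 * t ^ 2 * v i)
    linarith
  have hfun : (fun ω ↦ ∑ i, Y i ω ^ 2) = ∑ i, fun ω ↦ Z i ω ^ 2 := by
    ext ω
    simp [← hsum]
  constructor
  · by_contra hcon
    have hne : ∀ i, mgf (fun ω ↦ Z i ω ^ 2) P t ≠ 0 := fun i ↦ (mgf_pos (hi i)).ne'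
    have hz : mgf (∑ i, fun ω ↦ Z i ω ^ 2) P t = 0 := by
      rw [← hfun]
      exact mgf_undef hcon
    rw [hind2.mgf_sum₀ fun i ↦ (hZm i).pow_const 2, Finset.prod_eq_zero_iff] at hz
    obtain ⟨i, -, h⟩ := hz
    exact hne i h
  · rw [hfun, hind2.mgf_sum₀ fun i ↦ (hZm i).pow_const 2, ← hv, Finset.mul_sum, Real.exp_sum]
    exact Finset.prod_le_prod (fun _ _ ↦ mgf_nonneg) fun i _ ↦ hm i

/-- Concentration of the Euclidean norm of a centered Gaussian vector. -/
lemma ProbabilityTheory.HasGaussianLaw.measure_abs_sqrt_sum_sq_sub_ge_le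
    {Y : ι → Ω → ℝ} (hY : HasGaussianLaw (fun ω ↦ (Y · ω)) P) (h0 : ∀ i, ∫ ω, Y i ω ∂P = 0)
    {l : ℝ} (hl0 : 0 < l) (hl : ∀ i, ∑ j, |∫ ω, Y i ω * Y j ω ∂P| ≤ l) {h : ℝ} (hh : 0 < h) :
    P {ω | |√(∑ i, Y i ω ^ 2) - √(∑ i, ∫ ω, Y i ω ^ 2 ∂P)| ≥ h} ≤
      ENNReal.ofReal (2 * Real.exp (-(h ^ 2 / (8 * l)))) := by
  have := hY.isProbabilityMeasure
  set I := √(∑ i, ∫ ω, Y i ω ^ 2 ∂P)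
  have hI0 : 0 ≤ I := Real.sqrt_nonneg _
  have hI2 : ∑ i, ∫ ω, Y i ω ^ 2 ∂P = I ^ 2 :=
    (Real.sq_sqrt (Finset.sum_nonneg fun i _ ↦ integral_nonneg fun ω ↦ sq_nonneg _)).symm
  have hS0 : ∀ ω, 0 ≤ ∑ i, Y i ω ^ 2 := fun ω ↦ Finset.sum_nonneg fun i _ ↦ sq_nonneg _
  have hup : P.real {ω | (I + h) ^ 2 ≤ ∑ i, Y i ω ^ 2} ≤ Real.exp (-(h ^ 2 / (8 * l))) := by
    have hIh : 0 < I + h := by positivity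
    have ht : h / (4 * l * (I + h)) * l ≤ 1 / 4 := by
      rw [div_mul_eq_mul_div, div_le_div_iff₀ (by positivity) (by positivity)]
      nlinarith
    obtain ⟨hint, hmgf⟩ := hY.mgf_sum_sq_le h0 hl ht
    refine (measure_ge_le_exp_mul_mgf _ (by positivity) hint).trans
      ((mul_le_mul_of_nonneg_left hmgf (Real.exp_pos _).le).trans ?_)
    rw [← Real.exp_add, Real.exp_le_exp, hI2]
    have : -(h ^ 2 / (8 * l)) - (-(h / (4 * l * (I + h))) * (I + h) ^ 2 +
        (h / (4 * l * (I + h)) + 2 * (h / (4 * l * (I + h))) ^ 2 * l) * I ^ 2)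
        = h ^ 3 * (2 * I + h) / (8 * l * (I + h) ^ 2) + I * h ^ 2 / (4 * l * (I + h)) := by
      field_simp
      ring
    have h2 : 0 ≤ h ^ 3 * (2 * I + h) / (8 * l * (I + h) ^ 2) + I * h ^ 2 / (4 * l * (I + h)) := by
      positivity
    linarith
  have hlo : P.real {ω | √(∑ i, Y i ω ^ 2) ≤ I - h} ≤ Real.exp (-(h ^ 2 / (8 * l))) := by
    rcases lt_or_ge I h with hIh | hIh
    · have : {ω | √(∑ i, Y i ω ^ 2) ≤ I - h} = ∅ := by
        ext ω
        simp only [Set.mem_ofPred_eq, Set.mem_empty_iff_false, iff_false, not_le]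
        exact (sub_neg.2 hIh).trans_le (Real.sqrt_nonneg _)
      rw [this, measureReal_empty]
      positivity
    have hIpos : 0 < I := hh.trans_le hIh
    have ht0 : -(h / (4 * l * I)) ≤ 0 := by
      rw [neg_nonpos]
      positivity
    obtain ⟨hint, hmgf⟩ := hY.mgf_sum_sq_le h0 hl
      (t := -(h / (4 * l * I))) (by nlinarith)
    have hsub : {ω | √(∑ i, Y i ω ^ 2) ≤ I - h} ⊆ {ω | ∑ i, Y i ω ^ 2 ≤ (I - h) ^ 2} := fun ω hω ↦
      (Real.sqrt_le_left (sub_nonneg.2 hIh)).1 hω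
    refine (measureReal_mono hsub).trans ((measure_le_le_exp_mul_mgf _ ht0 hint).trans
      ((mul_le_mul_of_nonneg_left hmgf (Real.exp_pos _).le).trans ?_))
    rw [← Real.exp_add, Real.exp_le_exp, hI2]
    have : -(h ^ 2 / (8 * l)) - (-(-(h / (4 * l * I))) * (I - h) ^ 2 +
        (-(h / (4 * l * I)) + 2 * (-(h / (4 * l * I))) ^ 2 * l) * I ^ 2)
        = h ^ 2 * (I - h) / (4 * l * I) := by
      field_simp
      ring
    have h2 : 0 ≤ h ^ 2 * (I - h) / (4 * l * I) :=
      div_nonneg (mul_nonneg (sq_nonneg _) (sub_nonneg.2 hIh)) (by positivity)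
    linarith
  rw [ENNReal.le_ofReal_iff_toReal_le (measure_ne_top _ _) (by positivity)]
  change P.real _ ≤ _
  have hsub : {ω | |√(∑ i, Y i ω ^ 2) - I| ≥ h} ⊆
      {ω | (I + h) ^ 2 ≤ ∑ i, Y i ω ^ 2} ∪ {ω | √(∑ i, Y i ω ^ 2) ≤ I - h} := fun ω hω ↦ by
    rcases le_abs.1 (show h ≤ |√(∑ i, Y i ω ^ 2) - I| from hω) with h1 | h1
    · exact Or.inl ((Real.le_sqrt (by positivity) (hS0 ω)).1 (by linarith))
    · exact Or.inr (show √(∑ i, Y i ω ^ 2) ≤ I - h by linarith)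
  refine (measureReal_mono hsub).trans ((measureReal_union_le _ _).trans ?_)
  linarith

end GaussianVector

lemma sum_range_succ_rpow_le {a : ℝ} (ha : 0 < a) (ha1 : a ≤ 1) (N : ℕ) :
    ∑ m ∈ Finset.range N, ((m : ℝ) + 1) ^ (a - 1) ≤ (N : ℝ) ^ a / a := by
  induction N with
  | zero => simp [ha.ne']
  | succ n ih =>
    rw [Finset.sum_range_succ]
    have hn : (0 : ℝ) < n + 1 := by positivity
    have h1 : a * ((n : ℝ) + 1) ^ (a - 1) ≤ ((n : ℝ) + 1) ^ a - (n : ℝ) ^ a := by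
      have hs : (-1 : ℝ) ≤ -(1 / ((n : ℝ) + 1)) := by
        rw [neg_le_neg_iff, div_le_one hn]
        linarith [(Nat.cast_nonneg n : (0 : ℝ) ≤ n)]
      have h2 := rpow_one_add_le_one_add_mul_self hs ha.le ha1
      have h3 : 1 + -(1 / ((n : ℝ) + 1)) = n / (n + 1) := by
        field_simp
        ring
      rw [h3, Real.div_rpow (Nat.cast_nonneg n) hn.le, div_le_iff₀ (by positivity)] at h2
      rw [Real.rpow_sub_one hn.ne']
      have h4 : (1 + a * -(1 / ((n : ℝ) + 1))) * ((n : ℝ) + 1) ^ a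
          = ((n : ℝ) + 1) ^ a - a * (((n : ℝ) + 1) ^ a / (n + 1)) := by
        field_simp
        ring
      linarith
    have h5 : ((n : ℝ) + 1) ^ (a - 1) ≤ (((n : ℝ) + 1) ^ a - (n : ℝ) ^ a) / a := by
      rw [le_div_iff₀ ha]
      linarith
    rw [sub_div] at h5
    push_cast
    linarith

lemma sum_range_le_two_mul_sum_of_le_dist {N i : ℕ} (hi : i < N) {F g : ℕ → ℝ}
    (hg : ∀ m, 0 ≤ g m) (hle : ∀ j < N, F j ≤ g (Nat.dist i j)) :
    ∑ j ∈ Finset.range N, F j ≤ 2 * ∑ m ∈ Finset.range N, g m := by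
  have key : ∀ s ⊆ Finset.range N, Set.InjOn (Nat.dist i) s →
      ∑ j ∈ s, g (Nat.dist i j) ≤ ∑ m ∈ Finset.range N, g m := fun s hs hinj ↦ by
    rw [← Finset.sum_image (f := g) hinj]
    refine Finset.sum_le_sum_of_subset_of_nonneg (fun m hm ↦ ?_) fun m _ _ ↦ hg m
    obtain ⟨j, hj, rfl⟩ := Finset.mem_image.1 hm
    have := Finset.mem_range.1 (hs hj)
    simp only [Nat.dist, Finset.mem_range]
    omega
  calc ∑ j ∈ Finset.range N, F j
      ≤ ∑ j ∈ Finset.range N, g (Nat.dist i j) :=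
        Finset.sum_le_sum fun j hj ↦ hle j (Finset.mem_range.1 hj)
    _ = ∑ j ∈ Finset.range N with j ≤ i, g (Nat.dist i j) +
        ∑ j ∈ Finset.range N with ¬ j ≤ i, g (Nat.dist i j) :=
        (Finset.sum_filter_add_sum_filter_not _ _ _).symm
    _ ≤ _ := by
      rw [two_mul]
      refine add_le_add (key _ (Finset.filter_subset _ _) ?_)
        (key _ (Finset.filter_subset _ _) ?_) <;>
      · intro x hx y hy hxy
        simp only [Finset.coe_filter, Finset.mem_range, Set.mem_ofPred_eq, Nat.dist] at hx hy hxy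
        omega

section ClassX

variable {Ω : Type*} [MeasurableSpace Ω] {P : Measure Ω} {X : Ω → ℝ → ℝ} {H β c C T : ℝ}

lemma IsClassX.hasGaussianLaw [IsProbabilityMeasure P] (hX : IsClassX H β c C T P X) {n : ℕ}
    {t : Fin n → ℝ} (ht : ∀ i, t i ∈ Set.Icc 0 T) :
    HasGaussianLaw (fun ω i ↦ X ω (t i)) P where
  isGaussian_map := by
    have hm : Measurable fun ω i ↦ X ω (t i) := measurable_pi_lambda _ fun i ↦ hX.1 (t i)
    have := Measure.isProbabilityMeasure_map (μ := P) hm.aemeasurable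
    refine isGaussian_of_map_eq_gaussianReal fun L ↦ ?_
    obtain ⟨v, hv⟩ := hX.2.2.1 n t (fun i ↦ L (Pi.single i 1)) ht
    have hL : (P.map fun ω i ↦ X ω (t i)).map L = gaussianReal 0 v := by
      rw [Measure.map_map (by fun_prop) hm, ← hv]
      congr 1
      ext ω
      simp only [Function.comp_apply]
      conv_lhs => rw [← Finset.univ_sum_single (fun i ↦ X ω (t i)), map_sum]
      refine Finset.sum_congr rfl fun i _ ↦ ?_
      have hsingle : Pi.single i (X ω (t i)) = X ω (t i) • (Pi.single i 1 : Fin n → ℝ) := by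
        ext k
        simp [Pi.single_apply]
      rw [hsingle, map_smul, smul_eq_mul, mul_comm]
    exact ⟨0, v, hL⟩

lemma IsClassX.map_eq_gaussianReal (hX : IsClassX H β c C T P X) {t : ℝ} (ht : t ∈ Set.Icc 0 T) :
    ∃ v, P.map (fun ω ↦ X ω t) = gaussianReal 0 v := by
  simpa using hX.2.2.1 1 (fun _ ↦ t) (fun _ ↦ 1) fun _ ↦ ht

lemma IsClassX.memLp_two (hX : IsClassX H β c C T P X) {t : ℝ} (ht : t ∈ Set.Icc 0 T) :
    MemLp (fun ω ↦ X ω t) 2 P := by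
  obtain ⟨v, hv⟩ := hX.map_eq_gaussianReal ht
  have h := memLp_id_gaussianReal (μ := 0) (v := v) 2
  rw [← hv] at h
  exact h.comp_of_map (hX.1 t).aemeasurable

lemma IsClassX.integral_eq_zero (hX : IsClassX H β c C T P X) {t : ℝ} (ht : t ∈ Set.Icc 0 T) :
    ∫ ω, X ω t ∂P = 0 := by
  obtain ⟨v, hv⟩ := hX.map_eq_gaussianReal ht
  have h := integral_id_gaussianReal (μ := 0) (v := v)
  rwa [← hv, integral_map (hX.1 t).aemeasurable (by fun_prop)] at h

lemma IsClassX.integral_mul_increments (hX : IsClassX H β c C T P X) {p q r s : ℝ}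
    (hp : p ∈ Set.Icc 0 T) (hq : q ∈ Set.Icc 0 T) (hr : r ∈ Set.Icc 0 T) (hs : s ∈ Set.Icc 0 T) :
    2 * ∫ ω, (X ω q - X ω p) * (X ω s - X ω r) ∂P =
      ∫ ω, (X ω s - X ω p) ^ 2 ∂P - ∫ ω, (X ω s - X ω q) ^ 2 ∂P
      - (∫ ω, (X ω r - X ω p) ^ 2 ∂P - ∫ ω, (X ω r - X ω q) ^ 2 ∂P) := by
  have hi : ∀ {x y : ℝ}, x ∈ Set.Icc 0 T → y ∈ Set.Icc 0 T →
      Integrable (fun ω ↦ (X ω x - X ω y) ^ 2) P := fun hx hy ↦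
    ((hX.memLp_two hx).sub (hX.memLp_two hy)).integrable_sq
  have hi' : ∀ {x : ℝ}, x ∈ Set.Icc 0 T →
      Integrable (fun ω ↦ (X ω x - X ω p) ^ 2 - (X ω x - X ω q) ^ 2) P := fun hx ↦
    (hi hx hp).sub (hi hx hq)
  rw [← integral_sub (hi hs hp) (hi hs hq), ← integral_sub (hi hr hp) (hi hr hq),
    ← integral_sub (hi' hs) (hi' hr), ← integral_const_mul]
  congr 1
  ext ω
  ring

lemma IsClassX.abs_integral_mul_increments_le (hX : IsClassX H β c C T P X) (hH : H ≤ 1)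
    (hc : 0 ≤ c) {p q r s : ℝ} (hp : 0 ≤ p) (hpq : p < q) (hqr : q < r) (hrs : r < s) (hs : s ≤ T) :
    |∫ ω, (X ω q - X ω p) * (X ω s - X ω r) ∂P| ≤
      c / 2 * ((q - p) * (s - r)) * (r - q) ^ (2 * H - 2) := by
  have h2 := hX.integral_mul_increments (p := p) (q := q) (r := r) (s := s)
    ⟨by linarith, by linarith⟩ ⟨by linarith, by linarith⟩ ⟨by linarith, by linarith⟩
    ⟨by linarith, by linarith⟩
  obtain ⟨d1, d2, hd1, hd2, hd⟩ := hX.2.2.2.1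
  have hf : ∀ u ∈ Set.Icc r s,
      HasDerivAt (fun u ↦ ∫ ω, (X ω u - X ω p) ^ 2 ∂P - ∫ ω, (X ω u - X ω q) ^ 2 ∂P)
        (d1 p u - d1 q u) u := fun u ⟨hu1, hu2⟩ ↦
    (hd1 p u ⟨by linarith, by linarith⟩ ⟨by linarith, by linarith⟩ (by linarith)).sub
      (hd1 q u ⟨by linarith, by linarith⟩ ⟨by linarith, by linarith⟩ (by linarith))
  obtain ⟨ξ, hξ, hξe⟩ := exists_hasDerivAt_eq_slope _ _ hrs
    (fun u hu ↦ (hf u hu).continuousAt.continuousWithinAt)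
    (fun u hu ↦ hf u (Set.Ioo_subset_Icc_self hu))
  obtain ⟨hξ1, hξ2⟩ := hξ
  have hg : ∀ u ∈ Set.Icc p q, HasDerivAt (fun u ↦ d1 u ξ) (d2 u ξ) u := fun u ⟨hu1, hu2⟩ ↦
    hd2 u ξ ⟨by linarith, by linarith⟩ ⟨by linarith, by linarith⟩ (by linarith)
  obtain ⟨η, hη, hηe⟩ := exists_hasDerivAt_eq_slope _ _ hpq
    (fun u hu ↦ (hg u hu).continuousAt.continuousWithinAt)
    (fun u hu ↦ hg u (Set.Ioo_subset_Icc_self hu))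
  obtain ⟨hη1, hη2⟩ := hη
  have hb : |d2 η ξ| ≤ c * (r - q) ^ (2 * H - 2) := by
    refine (hd η ξ ⟨by linarith, by linarith⟩ ⟨by linarith, by linarith⟩ (by linarith)).trans ?_
    refine mul_le_mul_of_nonneg_left ?_ hc
    rw [abs_of_pos (by linarith)]
    exact Real.rpow_le_rpow_of_nonpos (by linarith) (by linarith) (by linarith)
  rw [eq_div_iff (by linarith)] at hξe hηe
  have : ∫ ω, (X ω q - X ω p) * (X ω s - X ω r) ∂P = -(((q - p) * (s - r)) / 2 * d2 η ξ) := by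
    have : d1 p ξ - d1 q ξ = -(d2 η ξ * (q - p)) := by linarith
    rw [this] at hξe
    linarith
  have hpos : 0 ≤ (q - p) * (s - r) / 2 :=
    div_nonneg (mul_nonneg (by linarith) (by linarith)) zero_le_two
  rw [this, abs_neg, abs_mul, abs_of_nonneg hpos]
  refine (mul_le_mul_of_nonneg_left hb hpos).trans_eq ?_
  ring

lemma IsClassX.abs_integral_mul_increments_le_of_le (hX : IsClassX H β c C T P X) {p q r s : ℝ}
    (hp : p ∈ Set.Icc 0 T) (hq : q ∈ Set.Icc 0 T) (hr : r ∈ Set.Icc 0 T) (hs : s ∈ Set.Icc 0 T)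
    {δ : ℝ} (hpq : |q - p| = δ) (hrs : |s - r| = δ) :
    |∫ ω, (X ω q - X ω p) * (X ω s - X ω r) ∂P| ≤ C * δ ^ (2 * H) := by
  have h1 := (hX.2.2.2.2 p q hp hq).2
  have h2 := (hX.2.2.2.2 r s hr hs).2
  rw [hpq] at h1
  rw [hrs] at h2
  have hi1 := ((hX.memLp_two hq).sub (hX.memLp_two hp)).integrable_sq
  have hi2 := ((hX.memLp_two hs).sub (hX.memLp_two hr)).integrable_sq
  simp only [Pi.sub_apply] at hi1 hi2
  calc |∫ ω, (X ω q - X ω p) * (X ω s - X ω r) ∂P|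
      ≤ ∫ ω, |(X ω q - X ω p) * (X ω s - X ω r)| ∂P := abs_integral_le_integral_abs
    _ ≤ ∫ ω, ((X ω q - X ω p) ^ 2 + (X ω s - X ω r) ^ 2) / 2 ∂P := by
      refine integral_mono_of_nonneg (ae_of_all _ fun _ ↦ abs_nonneg _)
        ((hi1.add hi2).div_const 2) (ae_of_all _ fun ω ↦ ?_)
      have := two_mul_le_add_sq |X ω q - X ω p| |X ω s - X ω r|
      simp only [sq_abs] at this
      simp only [abs_mul]
      linarith
    _ ≤ C * δ ^ (2 * H) := by
      rw [integral_div, integral_add hi1 hi2]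
      linarith

lemma IsClassX.abs_integral_mul_grid_increments_le (hX : IsClassX H β c C T P X)
    (hH : H ∈ Set.Icc (0 : ℝ) 1) (hc : 0 ≤ c) (hC : 0 ≤ C) {δ : ℝ} (hδ : 0 < δ) {N : ℕ}
    (hN : δ * N ≤ T) {j k : ℕ} (hjk : j ≤ k) (hk : k < N) :
    |∫ ω, (X ω ((j + 1) * δ) - X ω (j * δ)) * (X ω ((k + 1) * δ) - X ω (k * δ)) ∂P| ≤
      9 * (C + c) * δ ^ (2 * H) * (((k - j : ℕ) : ℝ) + 1) ^ (2 * H - 2) := by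
  have hmem : ∀ i : ℕ, i ≤ N → (i : ℝ) * δ ∈ Set.Icc 0 T := fun i hi ↦ by
    have : (i : ℝ) ≤ N := by exact_mod_cast hi
    exact ⟨by positivity, by nlinarith⟩
  have hmem' : ∀ i : ℕ, i < N → ((i : ℝ) + 1) * δ ∈ Set.Icc 0 T := fun i hi ↦ by
    exact_mod_cast hmem (i + 1) hi
  have h9 : (1 : ℝ) / 9 ≤ 3 ^ (2 * H - 2) := by
    calc (1 : ℝ) / 9 = 3 ^ (-2 : ℝ) := by
          rw [Real.rpow_neg (by norm_num)]
          norm_num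
      _ ≤ 3 ^ (2 * H - 2) := Real.rpow_le_rpow_of_exponent_le (by norm_num) (by linarith [hH.1])
  have hδH : 0 < δ ^ (2 * H) := Real.rpow_pos_of_pos hδ _
  obtain ⟨m, rfl⟩ := Nat.exists_eq_add_of_le hjk
  rw [Nat.add_sub_cancel_left]
  rcases le_or_gt m 1 with hm | hm
  · have hδj : ∀ i : ℝ, |(i + 1) * δ - i * δ| = δ := fun i ↦ by
      rw [← sub_mul, add_sub_cancel_left, one_mul, abs_of_pos hδ]
    refine (hX.abs_integral_mul_increments_le_of_le (hmem _ (by omega)) (hmem' _ (by omega))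
      (hmem _ hk.le) (hmem' _ hk) (hδj _) (hδj _)).trans ?_
    have hm' : (m : ℝ) ≤ 1 := by exact_mod_cast hm
    have h1 : (1 : ℝ) / 9 ≤ ((m : ℝ) + 1) ^ (2 * H - 2) :=
      h9.trans (Real.rpow_le_rpow_of_nonpos (by positivity) (by linarith) (by linarith [hH.2]))
    have h2 := mul_le_mul_of_nonneg_left h1 (by positivity : 0 ≤ 9 * (C + c) * δ ^ (2 * H))
    have : 0 ≤ c * δ ^ (2 * H) := by positivity
    linarith
  · have hm' : (2 : ℝ) ≤ m := by exact_mod_cast hm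
    have hs := (hmem' _ hk).2
    push_cast at hs ⊢
    refine (hX.abs_integral_mul_increments_le hH.2 hc (by positivity) (by nlinarith)
      (by nlinarith) (by nlinarith) hs).trans ?_
    have e1 : ((j : ℝ) + m) * δ - (j + 1) * δ = δ * (m - 1) := by ring
    have e2 : (((j : ℝ) + 1) * δ - j * δ) * ((j + m + 1) * δ - (j + m) * δ) = δ ^ (2 : ℝ) := by
      rw [Real.rpow_two]
      ring
    have h1 : ((m : ℝ) - 1) ^ (2 * H - 2) ≤ 9 * ((m : ℝ) + 1) ^ (2 * H - 2) := by
      calc ((m : ℝ) - 1) ^ (2 * H - 2) ≤ (((m : ℝ) + 1) / 3) ^ (2 * H - 2) :=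
            Real.rpow_le_rpow_of_nonpos (by positivity) (by linarith) (by linarith [hH.2])
        _ = ((m : ℝ) + 1) ^ (2 * H - 2) / 3 ^ (2 * H - 2) :=
            Real.div_rpow (by positivity) (by norm_num) _
        _ ≤ 9 * ((m : ℝ) + 1) ^ (2 * H - 2) := by
            rw [div_le_iff₀ (by positivity)]
            have := mul_le_mul_of_nonneg_left h9
              (by positivity : 0 ≤ 9 * ((m : ℝ) + 1) ^ (2 * H - 2))
            linarith
    rw [e1, e2, Real.mul_rpow hδ.le (by linarith)]
    have e3 : δ ^ (2 * H) = δ ^ (2 : ℝ) * δ ^ (2 * H - 2) := by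
      rw [← Real.rpow_add hδ]
      congr 1
      ring
    calc c / 2 * δ ^ (2 : ℝ) * (δ ^ (2 * H - 2) * ((m : ℝ) - 1) ^ (2 * H - 2))
        = c / 2 * δ ^ (2 * H) * ((m : ℝ) - 1) ^ (2 * H - 2) := by rw [e3]; ring
      _ ≤ (C + c) * δ ^ (2 * H) * (9 * ((m : ℝ) + 1) ^ (2 * H - 2)) := by
        have : 0 ≤ ((m : ℝ) - 1) ^ (2 * H - 2) := Real.rpow_nonneg (by linarith) _
        gcongr
        linarith
      _ = _ := by ring

lemma IsClassX.sum_abs_integral_mul_grid_increments_le (hX : IsClassX H β c C T P X)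
    (hH : H ∈ Set.Ioc (1 / 2 : ℝ) 1) (hc : 0 ≤ c) (hC : 0 ≤ C) {δ : ℝ} (hδ : 0 < δ) {N : ℕ}
    (hN : δ * N ≤ T) {i : ℕ} (hi : i < N) :
    ∑ j ∈ Finset.range N,
      |∫ ω, (X ω ((i + 1) * δ) - X ω (i * δ)) * (X ω ((j + 1) * δ) - X ω (j * δ)) ∂P| ≤
      18 * (C + c) / (2 * H - 1) * (δ ^ (2 * H) * (N : ℝ) ^ (2 * H - 1)) := by
  have hH' : H ∈ Set.Icc (0 : ℝ) 1 := ⟨by linarith [hH.1], hH.2⟩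
  have hpos : 0 ≤ 9 * (C + c) * δ ^ (2 * H) := by positivity
  refine (sum_range_le_two_mul_sum_of_le_dist hi
    (g := fun m ↦ 9 * (C + c) * δ ^ (2 * H) * ((m : ℝ) + 1) ^ (2 * H - 2))
    (fun m ↦ by positivity) fun j hj ↦ ?_).trans ?_
  · rcases le_total i j with h | h
    · rw [Nat.dist_eq_sub_of_le h]
      exact hX.abs_integral_mul_grid_increments_le hH' hc hC hδ hN h hj
    · rw [Nat.dist_eq_sub_of_le_right h]
      simp_rw [mul_comm (X _ ((i + 1) * δ) - X _ (i * δ))]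
      exact hX.abs_integral_mul_grid_increments_le hH' hc hC hδ hN h hi
  · rw [← Finset.mul_sum]
    have h1 := sum_range_succ_rpow_le (a := 2 * H - 1) (by linarith [hH.1]) (by linarith [hH.2]) N
    rw [show 2 * H - 1 - 1 = 2 * H - 2 by ring] at h1
    refine (mul_le_mul_of_nonneg_left (mul_le_mul_of_nonneg_left h1 hpos) zero_le_two).trans_eq ?_
    ring

end ClassX

/-- **Concentration for increments of processes in `𝒳^{(H,β)}`, case
`H > 1/2` (Theorem 8(1)).**  With `Y_k = X_{kδ} − X_{(k−1)δ}` and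
`I² = Σ_k E[Y_k²]`, there are constants `C₁, C₂ > 0` independent of `δ`, `N`
and `T` such that `P(|‖Y‖₂ − I| ≥ h) ≤ C₁·exp(−C₂·N·h²/(δN)^{2H})`. -/
theorem concentration_classX_high_H
    (H β c C : ℝ) (hH : H ∈ Set.Ioo (1/2 : ℝ) 1) (hβ : β ∈ Set.Ico H 1)
    (hc : 0 < c) (hC : 0 < C)
    {Ω : Type*} [MeasurableSpace Ω] (P : Measure Ω) [IsProbabilityMeasure P]
    (X : Ω → ℝ → ℝ) :
    ∃ C₁ C₂ : ℝ, 0 < C₁ ∧ 0 < C₂ ∧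
      ∀ T : ℝ, 0 < T → IsClassX H β c C T P X →
      ∀ (N : ℕ) (δ : ℝ), 0 < δ → δ * N < T →
      ∀ h : ℝ, 0 < h →
        P {ω | |Real.sqrt (∑ k ∈ Finset.Icc 1 N,
                  (X ω (k * δ) - X ω ((k - 1 : ℝ) * δ)) ^ 2) -
                Real.sqrt (∑ k ∈ Finset.Icc 1 N,
                  ∫ ω', (X ω' (k * δ) - X ω' ((k - 1 : ℝ) * δ)) ^ 2 ∂P)| ≥ h}
          ≤ ENNReal.ofReal
              (C₁ * Real.exp (-(C₂ * N * h ^ 2 / (δ * N) ^ (2 * H)))) := by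
  have hH1 : 0 < 2 * H - 1 := by linarith [hH.1]
  set K := 18 * (C + c) / (2 * H - 1)
  have hK0 : 0 < K := by positivity
  refine ⟨2, 1 / (8 * K), two_pos, by positivity, fun T _ hX N δ hδ hN h hh ↦ ?_⟩
  rcases Nat.eq_zero_or_pos N with rfl | hNpos
  · refine prob_le_one.trans ?_
    simp
  have hN0 : (0 : ℝ) < N := by exact_mod_cast hNpos
  have hmem : ∀ i : Fin (N + 1), ((i : ℕ) : ℝ) * δ ∈ Set.Icc 0 T := fun i ↦ by
    have : ((i : ℕ) : ℝ) ≤ N := by exact_mod_cast i.is_le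
    exact ⟨by positivity, by nlinarith⟩
  let Y : Fin N → Ω → ℝ := fun i ω ↦ X ω (((i : ℕ) + 1) * δ) - X ω ((i : ℕ) * δ)
  have hY : HasGaussianLaw (fun ω ↦ (Y · ω)) P :=
    (hX.hasGaussianLaw hmem).map_fun (ContinuousLinearMap.pi fun i : Fin N ↦
      ContinuousLinearMap.proj (R := ℝ) (φ := fun _ : Fin (N + 1) ↦ ℝ) i.succ -
        ContinuousLinearMap.proj i.castSucc) |>.congr (ae_of_all _ fun ω ↦ by ext i; simp [Y])
  have hY0 : ∀ i, ∫ ω, Y i ω ∂P = 0 := fun i ↦ by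
    have h1 := hmem i.succ
    have h2 := hmem i.castSucc
    simp only [Fin.val_succ, Fin.val_castSucc, Nat.cast_add, Nat.cast_one] at h1 h2
    simp only [Y]
    rw [integral_sub ((hX.memLp_two h1).integrable one_le_two)
      ((hX.memLp_two h2).integrable one_le_two), hX.integral_eq_zero h1, hX.integral_eq_zero h2,
      sub_zero]
  have hreindex : ∀ f : ℝ → ℝ, ∑ k ∈ Finset.Icc 1 N, f k = ∑ i : Fin N, f ((i : ℕ) + 1) :=
    fun f ↦ by
    have hIcc : Finset.Icc 1 N = Finset.Ico (0 + 1) (N + 1) := by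
      ext
      simp only [Finset.mem_Icc, Finset.mem_Ico]
      omega
    rw [Fin.sum_univ_eq_sum_range (fun i ↦ f (i + 1)), Finset.range_eq_Ico, hIcc,
      ← Finset.sum_Ico_add']
    simp
  have main := hY.measure_abs_sqrt_sum_sq_sub_ge_le hY0
    (l := K * (δ ^ (2 * H) * (N : ℝ) ^ (2 * H - 1))) (by positivity) (fun i ↦ by
      have := hX.sum_abs_integral_mul_grid_increments_le ⟨hH.1, hH.2.le⟩ hc.le hC.le hδ hN.le i.2
      rwa [← Fin.sum_univ_eq_sum_range (fun j ↦ |∫ ω, (X ω (((i : ℕ) + 1) * δ) - X ω ((i : ℕ) * δ))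
        * (X ω ((j + 1) * δ) - X ω (j * δ)) ∂P|)] at this) hh
  simp_rw [fun ω ↦ hreindex fun k ↦ (X ω (k * δ) - X ω ((k - 1) * δ)) ^ 2,
    hreindex fun k ↦ ∫ ω, (X ω (k * δ) - X ω ((k - 1) * δ)) ^ 2 ∂P, add_sub_cancel_right]
  refine main.trans_eq ?_
  congr 4
  rw [Real.mul_rpow hδ.le hN0.le, Real.rpow_sub_one hN0.ne']
  field_simp
end

section
/- Let H ∈ (0, 1/2) and let B^H = {B^H_t}_{t∈[0,T]} be a fractional Brownian motion with Hurst parameter H. Then there exist constants C_1, C_2 > 0, independent of ε and T, such that for every ε ∈ (0,1), P( sup_{t∈[0,T]} |B^H_t| ≤ ε ) ≤ C_1·exp( − C_2·T·ε^{−1/H} ). -/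
open MeasureTheory ProbabilityTheory

/-- `X` is a fractional Brownian motion with Hurst parameter `H` on `[0,∞)`:
a centered continuous Gaussian process with `X_0 = 0` and covariance
`E[X_s X_t] = (s^{2H} + t^{2H} − |t−s|^{2H})/2`. -/
def IsFBM {Ω : Type*} [MeasurableSpace Ω] (P : Measure Ω) (H : ℝ)
    (X : Ω → ℝ → ℝ) : Prop :=
  (∀ t, Measurable fun ω => X ω t) ∧
  (∀ᵐ ω ∂P, X ω 0 = 0) ∧
  (∀ᵐ ω ∂P, ContinuousOn (X ω) (Set.Ici 0)) ∧
  -- centered Gaussian process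
  (∀ (n : ℕ) (t coef : Fin n → ℝ), (∀ i, 0 ≤ t i) →
    ∃ v : NNReal,
      Measure.map (fun ω => ∑ i, coef i * X ω (t i)) P = gaussianReal 0 v) ∧
  -- covariance of fractional Brownian motion
  (∀ s t : ℝ, 0 ≤ s → 0 ≤ t →
    ∫ ω, X ω s * X ω t ∂P = (s ^ (2 * H) + t ^ (2 * H) - |t - s| ^ (2 * H)) / 2)

/-- Anti-concentration: a Gaussian law of variance at least `v` charges an interval of radius `r`
by at most `2r / √(2πv)`. -/
lemma gaussianReal_abs_add_le (m c r : ℝ) {v : ℝ} (hv : 0 < v) {w : NNReal} (hw : v ≤ w) :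
    gaussianReal m w {x | |x + c| ≤ r} ≤ ENNReal.ofReal (2 * r / √(2 * Real.pi * v)) := by
  have hw0 : w ≠ 0 := by
    rintro rfl
    simp only [NNReal.coe_zero] at hw
    linarith
  have hset : {x : ℝ | |x + c| ≤ r} = Set.Icc (-r - c) (r - c) := by
    ext x
    simp only [Set.mem_ofPred_eq, Set.mem_Icc, abs_le]
    constructor <;> rintro ⟨h₁, h₂⟩ <;> constructor <;> linarith
  have hpdf (x : ℝ) : gaussianPDF m w x ≤ ENNReal.ofReal (√(2 * Real.pi * v))⁻¹ := by
    refine ENNReal.ofReal_le_ofReal ?_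
    rw [gaussianPDFReal_def]
    calc (√(2 * Real.pi * w))⁻¹ * Real.exp (-(x - m) ^ 2 / (2 * w))
        ≤ (√(2 * Real.pi * v))⁻¹ * 1 := by
          have hexp : Real.exp (-(x - m) ^ 2 / (2 * w)) ≤ 1 := by
            refine Real.exp_le_one_iff.2 (div_nonpos_of_nonpos_of_nonneg ?_ (by positivity))
            nlinarith [sq_nonneg (x - m)]
          gcongr
      _ = _ := mul_one _
  rw [gaussianReal_apply m hw0, hset]
  calc ∫⁻ x in Set.Icc (-r - c) (r - c), gaussianPDF m w x
      ≤ ∫⁻ _ in Set.Icc (-r - c) (r - c), ENNReal.ofReal (√(2 * Real.pi * v))⁻¹ :=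
        lintegral_mono hpdf
    _ = ENNReal.ofReal (2 * r / √(2 * Real.pi * v)) := by
        rw [setLIntegral_const, Real.volume_Icc, ← ENNReal.ofReal_mul (by positivity)]
        congr 1
        ring

/-- Existence of the least-squares projection onto finitely many square-integrable variables. -/
lemma exists_integral_sub_sum_mul_eq_zero {Ω ι : Type*} [MeasurableSpace Ω] [Fintype ι]
    {P : Measure Ω} {Y : ι → Ω → ℝ} {Z : Ω → ℝ} (hY : ∀ i, MemLp (Y i) 2 P) (hZ : MemLp Z 2 P) :
    ∃ a : ι → ℝ, ∀ j, ∫ ω, (Z ω - ∑ i, a i * Y i ω) * Y j ω ∂P = 0 := by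
  let y : ι → Lp ℝ 2 P := fun i => (hY i).toLp
  let V : Submodule ℝ (Lp ℝ 2 P) := Submodule.span ℝ (Set.range y)
  have : FiniteDimensional ℝ V := FiniteDimensional.span_of_finite ℝ (Set.finite_range y)
  obtain ⟨a, ha⟩ := (Submodule.mem_span_range_iff_exists_fun ℝ).1
    (V.starProjection_apply_mem hZ.toLp)
  refine ⟨a, fun j => ?_⟩
  have horth : inner ℝ (y j) (hZ.toLp - ∑ i, a i • y i) = 0 := by
    rw [ha]
    exact (V.mem_orthogonal _).1 (V.sub_starProjection_mem_orthogonal _) _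
      (Submodule.subset_span ⟨j, rfl⟩)
  rw [L2.inner_def] at horth
  rw [← horth]
  have hsum : ∀ᵐ ω ∂P, (∑ i, a i • y i : Lp ℝ 2 P) ω = ∑ i, a i * Y i ω := by
    have h₁ := Lp.coeFn_finsetSum (μ := P) (p := 2) Finset.univ (fun i => a i • y i)
    have h₂ : ∀ᵐ ω ∂P, ∀ i, (a i • y i : Lp ℝ 2 P) ω = a i * Y i ω := by
      refine ae_all_iff.2 fun i => ?_
      filter_upwards [Lp.coeFn_smul (a i) (y i), (hY i).coeFn_toLp] with ω h₁ h₂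
      rw [h₁, Pi.smul_apply, h₂, smul_eq_mul]
    filter_upwards [h₁, h₂] with ω h₁ h₂
    rw [h₁, Finset.sum_apply]
    exact Finset.sum_congr rfl fun i _ => h₂ i
  refine integral_congr_ae ?_
  filter_upwards [Lp.coeFn_sub hZ.toLp (∑ i, a i • y i), hZ.coeFn_toLp, hsum,
    (hY j).coeFn_toLp] with ω h₁ h₂ h₃ h₄
  simp only [h₁, Pi.sub_apply, h₂, h₃, y, h₄, RCLike.inner_apply, conj_trivial]

/-- If the `n`-th term of a centered Gaussian sequence keeps variance at least `v` given the
preceding ones, requiring it to stay in `[-r, r]` as well costs a factor `2r / √(2πv)`. -/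
lemma measure_forall_abs_le_succ {Ω : Type*} [MeasurableSpace Ω] {P : Measure Ω}
    {Y : ℕ → Ω → ℝ} (hY : IsGaussianProcess Y P) (hmeas : ∀ i, Measurable (Y i))
    (hmean : ∀ i, ∫ ω, Y i ω ∂P = 0) {v : ℝ} (hv : 0 < v) (n : ℕ)
    (hvar : ∀ a : Fin n → ℝ, v ≤ ∫ ω, (Y n ω - ∑ i, a i * Y i ω) ^ 2 ∂P) (r : ℝ) :
    P {ω | ∀ i < n + 1, |Y i ω| ≤ r} ≤
      P {ω | ∀ i < n, |Y i ω| ≤ r} * ENNReal.ofReal (2 * r / √(2 * Real.pi * v)) := by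
  have := hY.isProbabilityMeasure
  have hL2 (i : ℕ) : MemLp (Y i) 2 P := (hY.hasGaussianLaw_eval i).memLp_two
  obtain ⟨a, ha⟩ := exists_integral_sub_sum_mul_eq_zero (P := P)
    (fun i : Fin n => hL2 i) (hL2 n)
  set η : Ω → ℝ := fun ω => Y n ω - ∑ i, a i * Y i ω with hη
  have hjoint : IsGaussianProcess (Sum.elim (fun i : Fin n => Y i) (fun _ : Unit => η)) P := by
    refine hY.of_isGaussianProcess fun s => ?_
    let e : ∀ i, i < n + 1 → Finset.range (n + 1) := fun i hi => ⟨i, Finset.mem_range.2 hi⟩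
    rcases s with i | _
    · exact ⟨Finset.range (n + 1), .proj (e i (by omega)), fun ω => rfl⟩
    · refine ⟨Finset.range (n + 1), ContinuousLinearMap.proj (R := ℝ) (φ := fun _ => ℝ)
        (e n (by omega)) - ∑ i : Fin n, a i • ContinuousLinearMap.proj (R := ℝ) (φ := fun _ => ℝ)
        (e i (by omega)), fun ω => ?_⟩
      simp [hη, e]
  have hηm : Measurable η := by fun_prop
  have hηL2 : MemLp η 2 P := (hjoint.hasGaussianLaw_eval (Sum.inr ())).memLp_two
  have hηG : HasGaussianLaw η P := hjoint.hasGaussianLaw_eval (Sum.inr ())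
  have hη0 : ∫ ω, η ω ∂P = 0 := by
    have hint (i : Fin n) : Integrable (fun ω => a i * Y i ω) P :=
      ((hL2 i).integrable one_le_two).const_mul _
    simp only [hη]
    rw [integral_sub ((hL2 n).integrable one_le_two) (integrable_finsetSum _ fun i _ => hint i),
      integral_finsetSum _ fun i _ => hint i]
    simp [integral_const_mul, hmean]
  have hind : IndepFun (fun ω (i : Fin n) => Y i ω) (fun ω (_ : Unit) => η ω) P := by
    refine hjoint.indepFun_of_covariance_eq_zero (fun i => (hmeas i).aemeasurable)
      (fun _ => hηm.aemeasurable) fun i _ => ?_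
    rw [covariance_comm, covariance_eq_sub hηL2 (hL2 i), hη0, zero_mul, sub_zero]
    exact ha i
  have hind' : IndepFun (fun ω (i : Fin n) => Y i ω) η P :=
    hind.comp measurable_id (measurable_pi_apply ())
  have hZm : Measurable fun ω (i : Fin n) => Y i ω := by fun_prop
  have hprod := (indepFun_iff_map_prod_eq_prod_map_map hZm.aemeasurable hηm.aemeasurable).1 hind'
  have hηlaw : P.map η = gaussianReal 0 Var[η; P].toNNReal := by
    rw [hηG.map_eq_gaussianReal, hη0]
  have hηvar : v ≤ Var[η; P].toNNReal := by
    refine le_trans ?_ (Real.le_coe_toNNReal _)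
    rw [variance_of_integral_eq_zero hηm.aemeasurable hη0]
    exact hvar a
  let S : Set (Fin n → ℝ) := {z | ∀ i, |z i| ≤ r}
  have hS : MeasurableSet S := by
    simp only [S, Set.ofPred_forall]
    exact MeasurableSet.iInter fun i => measurableSet_le (by fun_prop) measurable_const
  let A : Set ((Fin n → ℝ) × ℝ) := {p | p.1 ∈ S ∧ |p.2 + ∑ i, a i * p.1 i| ≤ r}
  have hA : MeasurableSet A := by
    have hm : Measurable fun p : (Fin n → ℝ) × ℝ => |p.2 + ∑ i, a i * p.1 i| := by fun_prop
    exact (measurable_fst hS).inter (measurableSet_le hm measurable_const)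
  have hpre : {ω | ∀ i < n + 1, |Y i ω| ≤ r} = (fun ω => ((fun i : Fin n => Y i ω), η ω)) ⁻¹' A := by
    ext ω
    simp only [Set.mem_ofPred_eq, Set.mem_preimage, A, S, hη, sub_add_cancel, Nat.lt_succ_iff_lt_or_eq,
      Fin.forall_iff]
    constructor
    · exact fun h => ⟨fun i hi => h i (.inl hi), h n (.inr rfl)⟩
    · rintro ⟨h₁, h₂⟩ i (hi | rfl)
      exacts [h₁ i hi, h₂]
  have hpreS : {ω | ∀ i < n, |Y i ω| ≤ r} = (fun ω (i : Fin n) => Y i ω) ⁻¹' S := by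
    ext ω
    simp [S, Fin.forall_iff]
  rw [hpre, hpreS, ← Measure.map_apply (hZm.prodMk hηm) hA, ← Measure.map_apply hZm hS, hprod,
    Measure.prod_apply hA, hηlaw]
  set q := ENNReal.ofReal (2 * r / √(2 * Real.pi * v))
  calc _ ≤ ∫⁻ z, S.indicator (fun _ => q) z ∂(P.map fun ω (i : Fin n) => Y i ω) := by
        refine lintegral_mono fun z => ?_
        by_cases hz : z ∈ S
        · rw [Set.indicator_of_mem hz]
          refine le_trans (measure_mono ?_) (gaussianReal_abs_add_le 0 (∑ i, a i * z i) r hv hηvar)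
          exact fun x hx => hx.2
        · have : Prod.mk z ⁻¹' A = ∅ := by
            ext x
            simp [A, hz]
          simp [this]
    _ = _ := by rw [lintegral_indicator_const hS, mul_comm]

/-- If each term of a centered Gaussian sequence keeps variance at least `v` given the preceding
ones, the probability that the first `n` terms stay in `[-r, r]` decays geometrically. -/
lemma measure_forall_abs_le_pow {Ω : Type*} [MeasurableSpace Ω] {P : Measure Ω}
    {Y : ℕ → Ω → ℝ} (hY : IsGaussianProcess Y P) (hmeas : ∀ i, Measurable (Y i))
    (hmean : ∀ i, ∫ ω, Y i ω ∂P = 0) {v : ℝ} (hv : 0 < v)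
    (hvar : ∀ n, ∀ a : Fin n → ℝ, v ≤ ∫ ω, (Y n ω - ∑ i, a i * Y i ω) ^ 2 ∂P) (r : ℝ) (n : ℕ) :
    P {ω | ∀ i < n, |Y i ω| ≤ r} ≤ ENNReal.ofReal (2 * r / √(2 * Real.pi * v)) ^ n := by
  have := hY.isProbabilityMeasure
  induction n with
  | zero => simp
  | succ n ih =>
    rw [pow_succ]
    exact (measure_forall_abs_le_succ hY hmeas hmean hv n (hvar n) r).trans (by gcongr)

/-- A symmetric quadratic form with nonpositive off-diagonal entries and nonnegative row sums is
bounded below by its last row sum times the square of the last coordinate. -/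
lemma le_sum_sum_mul_of_rowSum_nonneg {c : ℕ → ℕ → ℝ} {n : ℕ} {v : ℝ}
    (hsymm : ∀ i j, c i j = c j i) (hoff : ∀ i j, i ≠ j → c i j ≤ 0)
    (hrow : ∀ i ≤ n, 0 ≤ ∑ j ∈ Finset.range (n + 1), c i j)
    (hlast : v ≤ ∑ j ∈ Finset.range (n + 1), c n j) (x : ℕ → ℝ) :
    v * x n ^ 2 ≤ ∑ i ∈ Finset.range (n + 1), ∑ j ∈ Finset.range (n + 1), x i * x j * c i j := by
  have hpair (i j : ℕ) : (x i ^ 2 * c i j + x j ^ 2 * c j i) / 2 ≤ x i * x j * c i j := by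
    rw [hsymm j i]
    rcases eq_or_ne i j with rfl | hij
    · linarith
    · nlinarith [mul_nonneg (neg_nonneg.2 (hoff i j hij)) (sq_nonneg (x i - x j))]
  have hcomm : ∑ i ∈ Finset.range (n + 1), ∑ j ∈ Finset.range (n + 1), x j ^ 2 * c j i =
      ∑ i ∈ Finset.range (n + 1), ∑ j ∈ Finset.range (n + 1), x i ^ 2 * c i j :=
    Finset.sum_comm
  calc v * x n ^ 2 ≤ x n ^ 2 * ∑ j ∈ Finset.range (n + 1), c n j := by
        nlinarith [mul_le_mul_of_nonneg_left hlast (sq_nonneg (x n))]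
    _ ≤ ∑ i ∈ Finset.range (n + 1), x i ^ 2 * ∑ j ∈ Finset.range (n + 1), c i j :=
        Finset.single_le_sum (f := fun i => x i ^ 2 * ∑ j ∈ Finset.range (n + 1), c i j)
          (fun i hi => mul_nonneg (sq_nonneg _) (hrow i (by simpa [Nat.lt_succ_iff] using hi)))
          (Finset.self_mem_range_succ n)
    _ = ∑ i ∈ Finset.range (n + 1), ∑ j ∈ Finset.range (n + 1),
          (x i ^ 2 * c i j + x j ^ 2 * c j i) / 2 := by
        simp_rw [← Finset.sum_div, Finset.sum_add_distrib]
        rw [hcomm]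
        simp_rw [Finset.mul_sum]
        ring
    _ ≤ _ := Finset.sum_le_sum fun i _ => Finset.sum_le_sum fun j _ => hpair i j

namespace IsFBM

variable {Ω : Type*} [MeasurableSpace Ω] {P : Measure Ω} {H : ℝ} {X : Ω → ℝ → ℝ}

lemma isGaussianProcess (hX : IsFBM P H X) :
    IsGaussianProcess (fun (t : NNReal) ω => X ω t) P where
  hasGaussianLaw I := by
    obtain ⟨hm, -, -, hG, -⟩ := hX
    refine ⟨isGaussian_of_map_eq_gaussianReal fun L => ⟨0, ?_⟩⟩
    obtain ⟨w, hw⟩ := hG I.card (fun k => ((I.equivFin.symm k : I) : NNReal))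
      (fun k => L (Pi.single (I.equivFin.symm k) 1)) fun k => NNReal.coe_nonneg _
    refine ⟨w, ?_⟩
    have hmI : Measurable fun ω => I.restrict fun t : NNReal => X ω t :=
      measurable_pi_lambda _ fun t => hm _
    rw [Measure.map_map L.continuous.measurable hmI, ← hw]
    congr 1
    ext ω
    rw [I.equivFin.symm.sum_comp fun t : I => L (Pi.single t 1) * X ω t, Function.comp_apply]
    exact (L.toLinearMap.pi_apply_eq_sum_univ _).trans
      (Finset.sum_congr rfl fun t _ => by
        have hsingle : (fun j => if t = j then (1 : ℝ) else 0) = Pi.single t 1 := by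
          ext j
          simp [Pi.single_apply, eq_comm]
        simp [hsingle, mul_comm])

lemma memLp_two (hX : IsFBM P H X) {t : ℝ} (ht : 0 ≤ t) : MemLp (fun ω => X ω t) 2 P :=
  (hX.isGaussianProcess.hasGaussianLaw_eval ⟨t, ht⟩).memLp_two

lemma integral_eq_zero (hX : IsFBM P H X) {t : ℝ} (ht : 0 ≤ t) : ∫ ω, X ω t ∂P = 0 := by
  obtain ⟨w, hw⟩ := hX.2.2.2.1 1 (fun _ => t) (fun _ => 1) fun _ => ht
  simp only [Finset.univ_unique, Finset.sum_const, Finset.card_singleton, one_smul, one_mul] at hw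
  have h := integral_map (μ := P) (hX.1 t).aemeasurable (f := fun x : ℝ => x)
    aestronglyMeasurable_id
  rw [← h, hw, integral_id_gaussianReal]

lemma isGaussianProcess_increment (hX : IsFBM P H X) {δ : ℝ} (hδ : 0 ≤ δ) :
    IsGaussianProcess (fun (i : ℕ) ω => X ω ((i + 1) * δ) - X ω (i * δ)) P := by
  let t : ℕ → NNReal := fun i => i * ⟨δ, hδ⟩
  refine hX.isGaussianProcess.of_isGaussianProcess fun i => ⟨{t i, t (i + 1)},
    ContinuousLinearMap.proj (R := ℝ) (φ := fun _ => ℝ) ⟨t (i + 1), by simp⟩ -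
      ContinuousLinearMap.proj (R := ℝ) (φ := fun _ => ℝ) ⟨t i, by simp⟩, fun ω => ?_⟩
  have ht (k : ℕ) : (t k : ℝ) = k * δ := rfl
  simp [ht]

/-- The covariance of two increments, as a second difference. -/
lemma integral_increment_mul_increment (hX : IsFBM P H X) {a b c d : ℝ} (ha : 0 ≤ a) (hb : 0 ≤ b)
    (hc : 0 ≤ c) (hd : 0 ≤ d) :
    ∫ ω, (X ω b - X ω a) * (X ω d - X ω c) ∂P =
      (|d - a| ^ (2 * H) - |d - b| ^ (2 * H)) / 2 -
        (|c - a| ^ (2 * H) - |c - b| ^ (2 * H)) / 2 := by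
  have hint {s t : ℝ} (hs : 0 ≤ s) (ht : 0 ≤ t) : Integrable (fun ω => X ω s * X ω t) P :=
    (hX.memLp_two hs).integrable_mul (hX.memLp_two ht)
  have hexp : (fun ω => (X ω b - X ω a) * (X ω d - X ω c)) = fun ω =>
      (X ω b * X ω d - X ω b * X ω c) - (X ω a * X ω d - X ω a * X ω c) := by
    ext ω
    ring
  rw [hexp, integral_sub (f := fun ω => X ω b * X ω d - X ω b * X ω c)
      (g := fun ω => X ω a * X ω d - X ω a * X ω c) ((hint hb hd).sub (hint hb hc))
      ((hint ha hd).sub (hint ha hc)),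
    integral_sub (hint hb hd) (hint hb hc), integral_sub (hint ha hd) (hint ha hc)]
  obtain ⟨-, -, -, -, hcov⟩ := hX
  rw [hcov b d hb hd, hcov b c hb hc, hcov a d ha hd, hcov a c ha hc]
  ring

/-- For `H ≤ 1/2`, distinct increments over a regular grid are nonpositively correlated. -/
lemma integral_increment_mul_increment_nonpos (hX : IsFBM P H X) (hH₀ : 0 ≤ H) (hH : H ≤ 1 / 2)
    {δ : ℝ} (hδ : 0 ≤ δ) {i j : ℕ} (hij : i < j) :
    ∫ ω, (X ω ((i + 1) * δ) - X ω (i * δ)) * (X ω ((j + 1) * δ) - X ω (j * δ)) ∂P ≤ 0 := by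
  rw [hX.integral_increment_mul_increment (by positivity) (by positivity) (by positivity)
    (by positivity)]
  have hij' : (i : ℝ) + 1 ≤ j := by exact_mod_cast hij
  have h₁ : 0 ≤ ((j : ℝ) - i - 1) * δ := mul_nonneg (by linarith) hδ
  have h₂ : 0 ≤ ((j : ℝ) - i + 1) * δ := mul_nonneg (by linarith) hδ
  have h₃ : 0 ≤ ((j : ℝ) - i) * δ := mul_nonneg (by linarith) hδ
  have hconc := (Real.concaveOn_rpow (p := 2 * H) (by linarith) (by linarith)).2
    (Set.mem_Ici.2 h₁) (Set.mem_Ici.2 h₂) 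
    (by norm_num : (0 : ℝ) ≤ 1 / 2) (by norm_num : (0 : ℝ) ≤ 1 / 2) (by norm_num)
  simp only [smul_eq_mul] at hconc
  rw [show 1 / 2 * (((j : ℝ) - i - 1) * δ) + 1 / 2 * (((j : ℝ) - i + 1) * δ) = (j - i) * δ by ring]
    at hconc
  rw [show ((j : ℝ) + 1) * δ - i * δ = (j - i + 1) * δ by ring,
    show ((j : ℝ) + 1) * δ - (i + 1) * δ = (j - i) * δ by ring,
    show (j : ℝ) * δ - i * δ = (j - i) * δ by ring,
    show (j : ℝ) * δ - (i + 1) * δ = (j - i - 1) * δ by ring,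
    abs_of_nonneg h₁, abs_of_nonneg h₂, abs_of_nonneg h₃]
  linarith

/-- The covariance of an increment with the total displacement over the grid. -/
lemma sum_integral_increment_mul_increment (hX : IsFBM P H X) {δ : ℝ} (hδ : 0 ≤ δ) {i n : ℕ}
    (hi : i ≤ n) :
    ∑ j ∈ Finset.range (n + 1),
      ∫ ω, (X ω ((i + 1) * δ) - X ω (i * δ)) * (X ω ((j + 1) * δ) - X ω (j * δ)) ∂P =
    (((n + 1 - i) * δ) ^ (2 * H) - ((n - i) * δ) ^ (2 * H)) / 2 +
      (((i + 1) * δ) ^ (2 * H) - (i * δ) ^ (2 * H)) / 2 := by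
  let f : ℕ → ℝ := fun j =>
    (|j * δ - i * δ| ^ (2 * H) - |j * δ - (i + 1) * δ| ^ (2 * H)) / 2
  have hf (j : ℕ) :
      ∫ ω, (X ω ((i + 1) * δ) - X ω (i * δ)) * (X ω ((j + 1) * δ) - X ω (j * δ)) ∂P =
        f (j + 1) - f j := by
    rw [hX.integral_increment_mul_increment (by positivity) (by positivity) (by positivity)
      (by positivity)]
    simp [f]
  have hi' : (i : ℝ) ≤ n := by exact_mod_cast hi
  simp_rw [hf]
  rw [Finset.sum_range_sub f]
  simp only [f, Nat.cast_zero, zero_mul, zero_sub, abs_neg, Nat.cast_add, Nat.cast_one]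
  rw [show ((n : ℝ) + 1) * δ - i * δ = (n + 1 - i) * δ by ring,
    show ((n : ℝ) + 1) * δ - (i + 1) * δ = (n - i) * δ by ring,
    abs_of_nonneg (mul_nonneg (by linarith : (0 : ℝ) ≤ n + 1 - i) hδ),
    abs_of_nonneg (mul_nonneg (by linarith : (0 : ℝ) ≤ n - i) hδ),
    abs_of_nonneg (by positivity : (0 : ℝ) ≤ i * δ),
    abs_of_nonneg (by positivity : (0 : ℝ) ≤ (i + 1) * δ)]
  ring

/-- For `0 < H ≤ 1/2`, an increment keeps at least half of its variance when the preceding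
increments on the grid are known. -/
lemma half_le_integral_increment_sub_sum_sq (hX : IsFBM P H X) (hH₀ : 0 < H) (hH : H ≤ 1 / 2)
    {δ : ℝ} (hδ : 0 ≤ δ) (n : ℕ) (a : Fin n → ℝ) :
    δ ^ (2 * H) / 2 ≤ ∫ ω, ((X ω ((n + 1) * δ) - X ω (n * δ)) -
      ∑ i, a i * (X ω (((i : ℕ) + 1) * δ) - X ω ((i : ℕ) * δ))) ^ 2 ∂P := by
  set Y : ℕ → Ω → ℝ := fun i ω => X ω ((i + 1) * δ) - X ω (i * δ) with hY
  have hL2 (i : ℕ) : MemLp (Y i) 2 P :=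
    (hX.memLp_two (by positivity)).sub (hX.memLp_two (by positivity))
  have hint (i j : ℕ) : Integrable (fun ω => Y i ω * Y j ω) P := (hL2 i).integrable_mul (hL2 j)
  let x : ℕ → ℝ := fun i => if h : i < n then -a ⟨i, h⟩ else 1
  let c : ℕ → ℕ → ℝ := fun i j => ∫ ω, Y i ω * Y j ω ∂P
  have hsymm (i j : ℕ) : c i j = c j i := by simp only [c, mul_comm]
  have hmono {s t : ℝ} (hs : 0 ≤ s) (hst : s ≤ t) : (s * δ) ^ (2 * H) ≤ (t * δ) ^ (2 * H) :=
    Real.rpow_le_rpow (mul_nonneg hs hδ) (mul_le_mul_of_nonneg_right hst hδ) (by linarith)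
  have hquad : ∫ ω, (Y n ω - ∑ i : Fin n, a i * Y i ω) ^ 2 ∂P =
      ∑ i ∈ Finset.range (n + 1), ∑ j ∈ Finset.range (n + 1), x i * x j * c i j := by
    have hexp (ω : Ω) : (Y n ω - ∑ i : Fin n, a i * Y i ω) ^ 2 =
        ∑ i ∈ Finset.range (n + 1), ∑ j ∈ Finset.range (n + 1), x i * x j * (Y i ω * Y j ω) := by
      have hlin : Y n ω - ∑ i : Fin n, a i * Y i ω =
          ∑ i ∈ Finset.range (n + 1), x i * Y i ω := by
        rw [Finset.sum_range_succ, Finset.sum_range]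
        simp [x]
        ring
      rw [hlin, sq, Finset.sum_mul_sum]
      exact Finset.sum_congr rfl fun i _ => Finset.sum_congr rfl fun j _ => by ring
    simp_rw [hexp]
    rw [integral_finsetSum _ fun i _ => integrable_finsetSum _ fun j _ => (hint i j).const_mul _]
    refine Finset.sum_congr rfl fun i _ => ?_
    rw [integral_finsetSum _ fun j _ => (hint i j).const_mul _]
    exact Finset.sum_congr rfl fun j _ => integral_const_mul _ _
  have hmain := le_sum_sum_mul_of_rowSum_nonneg (c := c) (n := n) (v := δ ^ (2 * H) / 2) hsymm
    (fun i j hij => by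
      rcases hij.lt_or_gt with h | h
      · exact hX.integral_increment_mul_increment_nonpos hH₀.le hH hδ h
      · rw [hsymm]
        exact hX.integral_increment_mul_increment_nonpos hH₀.le hH hδ h)
    (fun i hi => by
      have hi' : (i : ℝ) ≤ n := by exact_mod_cast hi
      have h₁ := hmono (s := n - i) (t := n + 1 - i) (by linarith) (by linarith)
      have h₂ := hmono (s := i) (t := i + 1) (by positivity) (by linarith)
      have h₃ := hX.sum_integral_increment_mul_increment hδ hi
      simp only [c, hY]
      linarith)
    (by
      have h₂ := hmono (s := n) (t := n + 1) (by positivity) (by linarith)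
      have h₃ := hX.sum_integral_increment_mul_increment hδ (le_refl n)
      have h₄ : (0 : ℝ) ^ (2 * H) = 0 := Real.zero_rpow (by linarith)
      rw [sub_self, zero_mul, h₄, show ((n : ℝ) + 1 - n) = 1 by ring, one_mul] at h₃
      simp only [c, hY]
      linarith) x
  rw [hquad]
  simpa [x] using hmain

/-- Small-ball estimate for the first `n` increments over a regular grid. -/
lemma measure_forall_abs_increment_le (hX : IsFBM P H X) (hH₀ : 0 < H) (hH : H ≤ 1 / 2)
    {δ : ℝ} (hδ : 0 < δ) (r : ℝ) (n : ℕ) :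
    P {ω | ∀ i < n, |X ω ((i + 1) * δ) - X ω (i * δ)| ≤ r} ≤
      ENNReal.ofReal (2 * r / √(Real.pi * δ ^ (2 * H))) ^ n := by
  have := hX.isGaussianProcess.isProbabilityMeasure
  have h := measure_forall_abs_le_pow (hX.isGaussianProcess_increment hδ.le)
    (fun i => (hX.1 _).sub (hX.1 _))
    (fun i => by
      rw [integral_sub ((hX.memLp_two (by positivity)).integrable one_le_two)
        ((hX.memLp_two (by positivity)).integrable one_le_two), hX.integral_eq_zero (by positivity),
        hX.integral_eq_zero (by positivity), sub_zero])
    (by positivity : 0 < δ ^ (2 * H) / 2)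
    (hX.half_le_integral_increment_sub_sum_sq hH₀ hH hδ.le) r n
  rwa [show 2 * Real.pi * (δ ^ (2 * H) / 2) = Real.pi * δ ^ (2 * H) by ring] at h

end IsFBM

/-- **Small deviation for fractional Brownian motion in the supremum norm,
`H < 1/2`.**  There are constants `C₁, C₂ > 0` independent of `ε` and `T` such
that for every `T > 0` and `ε ∈ (0,1)`,
`P(sup_{t∈[0,T]} |B^H_t| ≤ ε) ≤ C₁·exp(−C₂·T·ε^{−1/H})`. -/
theorem small_deviation_fbm_sup_norm
    (H : ℝ) (hH : H ∈ Set.Ioo (0:ℝ) (1/2))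
    {Ω : Type*} [MeasurableSpace Ω] (P : Measure Ω) [IsProbabilityMeasure P]
    (X : Ω → ℝ → ℝ) (hX : IsFBM P H X) :
    ∃ C₁ C₂ : ℝ, 0 < C₁ ∧ 0 < C₂ ∧
      ∀ T : ℝ, 0 < T → ∀ ε ∈ Set.Ioo (0:ℝ) 1,
        P {ω | (⨆ t : Set.Icc (0:ℝ) T, |X ω t|) ≤ ε}
          ≤ ENNReal.ofReal (C₁ * Real.exp (-(C₂ * T * ε ^ (-(1 / H))))) := by
  obtain ⟨hH₀, hH₁⟩ := hH
  refine ⟨Real.exp 1, (4 * Real.exp 1) ^ (-(1 / H)), by positivity, by positivity,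
    fun T hT ε hε => ?_⟩
  have hε₀ : 0 < ε := hε.1
  set δ : ℝ := (4 * Real.exp 1 * ε) ^ (1 / H) with hδ_def
  have hδ : 0 < δ := by positivity
  have hδH : δ ^ (2 * H) = (4 * Real.exp 1 * ε) ^ 2 := by
    rw [hδ_def, ← Real.rpow_mul (by positivity), show 1 / H * (2 * H) = (2 : ℕ) by
      field_simp; norm_num, Real.rpow_natCast]
  have hratio : 2 * (2 * ε) / √(Real.pi * δ ^ (2 * H)) ≤ Real.exp (-1) := by
    have hsqrt : 4 * Real.exp 1 * ε ≤ √(Real.pi * δ ^ (2 * H)) := by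
      refine Real.le_sqrt_of_sq_le ?_
      rw [hδH]
      exact le_mul_of_one_le_left (sq_nonneg _) (by linarith [Real.pi_gt_three])
    rw [div_le_iff₀ (lt_of_lt_of_le (by positivity) hsqrt)]
    calc 2 * (2 * ε) = Real.exp (-1) * (4 * Real.exp 1 * ε) := by
          rw [Real.exp_neg]
          field_simp
          ring
      _ ≤ _ := by gcongr
  set n : ℕ := ⌊T / δ⌋₊
  have hnT : n * δ ≤ T := (le_div_iff₀ hδ).1 (Nat.floor_le (by positivity))
  have hsub : P {ω | (⨆ t : Set.Icc (0:ℝ) T, |X ω t|) ≤ ε} ≤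
      P {ω | ∀ i < n, |X ω ((i + 1) * δ) - X ω (i * δ)| ≤ 2 * ε} := by
    refine measure_mono_ae ?_
    filter_upwards [hX.2.2.1] with ω hcont hω i hi
    have hbdd : BddAbove (Set.range fun t : Set.Icc (0:ℝ) T => |X ω t|) := by
      have := isCompact_Icc.bddAbove_image (hcont.abs.mono (Set.Icc_subset_Ici_self : Set.Icc 0 T ⊆ _))
      rwa [Set.image_eq_range] at this
    have hle (t : ℝ) (h₀ : 0 ≤ t) (h₁ : t ≤ T) : |X ω t| ≤ ε :=
      (le_ciSup hbdd ⟨t, h₀, h₁⟩).trans hω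
    have hin : (i : ℝ) + 1 ≤ n := by exact_mod_cast hi
    have h₁ : ((i : ℝ) + 1) * δ ≤ T := (mul_le_mul_of_nonneg_right hin hδ.le).trans hnT
    have h₂ := hle ((i + 1) * δ) (by positivity) h₁
    have h₃ := hle (i * δ) (by positivity) (by nlinarith)
    linarith [abs_sub (X ω ((i + 1) * δ)) (X ω (i * δ))]
  refine hsub.trans <| (hX.measure_forall_abs_increment_le hH₀ hH₁.le hδ _ n).trans ?_
  rw [← ENNReal.ofReal_pow (by positivity)]
  refine ENNReal.ofReal_le_ofReal ?_
  calc (2 * (2 * ε) / √(Real.pi * δ ^ (2 * H))) ^ n ≤ Real.exp (-1) ^ n := by gcongr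
    _ = Real.exp (-n) := by rw [← Real.exp_nat_mul, mul_neg_one]
    _ ≤ Real.exp (1 + -(T / δ)) := by
        refine Real.exp_le_exp.2 ?_
        linarith [Nat.lt_floor_add_one (T / δ)]
    _ = _ := by
        rw [Real.exp_add, hδ_def, Real.rpow_neg (by positivity), Real.rpow_neg (by positivity),
          Real.mul_rpow (by positivity) (by positivity)]
        congr 3
        field_simp
end
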